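/- arXiv:cs/0407007 — 7 statements merged into one kernel-verified Lean document; each statement's English description precedes it below -/
import Mathlib

section
/- For every semijoin algebra expression E over SA= of arity k, for every database A over the schema S, and for every tuple z = (z_1,…,z_k) ∈ E(A), there exist a relation name R ∈ S, an injective function f : {1,…,k} → {1,…,arity(R)}, and a tuple t ∈ A(R) such that z_i = t_{f(i)} for all i = 1,…,k. -/
/-!
Statement 0: For every SA= expression `E` of arity `k`, every database `A` over the
schema `S`, and every tuple `z ∈ E(A)`, there exist a relation name `R ∈ S`, an
injective function `f : {1,…,k} → {1,…,arity(R)}`, and a tuple `t ∈ A(R)` such that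
`z_i = t_(f i)` for all `i`.
-/

/-- Quantifier-free formulas over a vocabulary `Ω` of predicates (with arities
given by `ωar`) and with equality built in, on `n` variables. -/
inductive QF (Ω : Type) (ωar : Ω → ℕ) : ℕ → Type
  | atom {n : ℕ} (p : Ω) (v : Fin (ωar p) → Fin n) : QF Ω ωar n
  | eq {n : ℕ} (i j : Fin n) : QF Ω ωar n
  | not {n : ℕ} : QF Ω ωar n → QF Ω ωar n
  | and {n : ℕ} : QF Ω ωar n → QF Ω ωar n → QF Ω ωar n
  | or {n : ℕ} : QF Ω ωar n → QF Ω ωar n → QF Ω ωar n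

/-- Semantics of quantifier-free formulas, given an interpretation `I` of the
predicates of `Ω` over the universe `U`. -/
def QF.holds {Ω : Type} {ωar : Ω → ℕ} {U : Type}
    (I : ∀ p : Ω, (Fin (ωar p) → U) → Prop) :
    ∀ {n : ℕ}, QF Ω ωar n → (Fin n → U) → Prop
  | _, .atom p v, t => I p (t ∘ v)
  | _, .eq i j, t => t i = t j
  | _, .not φ, t => ¬ QF.holds I φ t
  | _, .and φ ψ, t => QF.holds I φ t ∧ QF.holds I ψ t
  | _, .or φ ψ, t => QF.holds I φ t ∨ QF.holds I ψ t

/-- Quantifier-free formulas over the vocabulary `Ω = {=}` (equality only). -/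
abbrev EqForm (n : ℕ) : Type := QF Empty (fun p => p.elim) n

/-- Semantics of quantifier-free formulas over equality. -/
def EqForm.holds {U : Type} {n : ℕ} (θ : EqForm n) (t : Fin n → U) : Prop :=
  QF.holds (fun p => p.elim) θ t

/-- The semijoin algebra SA= over a schema `S` (with arities `ar`): expressions are
built from relation names by union and difference of equal-arity expressions,
projection `π_X` (encoded by a strictly increasing list of columns, i.e. a strictly
monotone map), selection `σ_θ` with `θ` an arbitrary quantifier-free formula over
equality, and semijoin `E₁ ⋉_θ E₂` where the semijoin condition `θ` is a conjunction
of equalities `x_i = y_j` (encoded as a list of pairs of columns). An expression is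
indexed by its arity. -/
inductive SAeq (S : Type) (ar : S → ℕ) : ℕ → Type
  | rel (R : S) : SAeq S ar (ar R)
  | union {n : ℕ} : SAeq S ar n → SAeq S ar n → SAeq S ar n
  | diff {n : ℕ} : SAeq S ar n → SAeq S ar n → SAeq S ar n
  | proj {k n : ℕ} (f : Fin k → Fin n) (hf : StrictMono f) :
      SAeq S ar n → SAeq S ar k
  | sel {n : ℕ} (θ : EqForm n) : SAeq S ar n → SAeq S ar n
  | semijoin {n m : ℕ} (θ : List (Fin n × Fin m)) :
      SAeq S ar n → SAeq S ar m → SAeq S ar n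

/-- Evaluation of an SA= expression on a database `D` over the schema `S`. -/
def SAeq.eval {S : Type} {ar : S → ℕ} {U : Type}
    (D : ∀ R : S, Set (Fin (ar R) → U)) :
    ∀ {n : ℕ}, SAeq S ar n → Set (Fin n → U)
  | _, .rel R => D R
  | _, .union E₁ E₂ => SAeq.eval D E₁ ∪ SAeq.eval D E₂
  | _, .diff E₁ E₂ => SAeq.eval D E₁ \ SAeq.eval D E₂
  | _, .proj f _ E => {t | ∃ a ∈ SAeq.eval D E, t = a ∘ f}
  | _, .sel θ E => {a ∈ SAeq.eval D E | θ.holds a}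
  | _, .semijoin θ E₁ E₂ =>
      {a ∈ SAeq.eval D E₁ | ∃ b ∈ SAeq.eval D E₂, ∀ p ∈ θ, a p.1 = b p.2}

/-- Every tuple in the result of an SA= expression is, componentwise,
an injective selection of components of some tuple of some relation of the database. -/
theorem stmt0 {U : Type} {S : Type} (ar : S → ℕ) {k : ℕ} (E : SAeq S ar k)
    (A : ∀ R : S, Set (Fin (ar R) → U)) (hfin : ∀ R : S, (A R).Finite)
    (z : Fin k → U) (hz : z ∈ E.eval A) :
    ∃ (R : S) (f : Fin k → Fin (ar R)), Function.Injective f ∧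
      ∃ t ∈ A R, ∀ i : Fin k, z i = t (f i) := by
  clear hfin
  induction E with
  | rel R => exact ⟨R, id, Function.injective_id, z, hz, fun _ => rfl⟩
  | union E₁ E₂ ih₁ ih₂ => exact hz.elim (ih₁ z) (ih₂ z)
  | diff E₁ E₂ ih₁ _ => exact ih₁ z hz.1
  | proj f hf E ih =>
    obtain ⟨a, ha, rfl⟩ := hz
    obtain ⟨R, g, hg, t, ht, h⟩ := ih a ha
    exact ⟨R, g ∘ f, hg.comp hf.injective, t, ht, fun i => h (f i)⟩
  | sel θ E ih => exact ih z hz.1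
  | semijoin θ E₁ E₂ ih₁ _ => exact ih₁ z hz.1
end

section
/- For every SA= expression E of arity k there exists a formula φ_E(x_1,…,x_k) of the guarded fragment GF over the same schema such that for every database D, E(D) = { d̄ ∈ U^k | D ⊨ φ_E(d̄) } (with first-order semantics relativized to the active domain of D). -/
/-- First-order formulas over the schema `S` (relation names with arities `ar`)
and equality, with variables drawn from `ℕ`. -/
inductive FO (S : Type) (ar : S → ℕ) : Type
  | rel (R : S) (v : Fin (ar R) → ℕ) : FO S ar
  | eq (x y : ℕ) : FO S ar
  | not (φ : FO S ar) : FO S ar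
  | and (φ ψ : FO S ar) : FO S ar
  | or (φ ψ : FO S ar) : FO S ar
  | ex (y : ℕ) (φ : FO S ar) : FO S ar

/-- The set of free variables of a first-order formula. -/
def FO.free {S : Type} {ar : S → ℕ} : FO S ar → Set ℕ
  | .rel _ v => Set.range v
  | .eq x y => {x, y}
  | .not φ => φ.free
  | .and φ ψ => φ.free ∪ ψ.free
  | .or φ ψ => φ.free ∪ ψ.free
  | .ex y φ => φ.free \ {y}

/-- The active domain of a database: all values occurring in some relation. -/
def adom {S : Type} {ar : S → ℕ} {U : Type}
    (D : ∀ R : S, Set (Fin (ar R) → U)) : Set U :=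
  {u | ∃ (R : S) (t : Fin (ar R) → U), t ∈ D R ∧ ∃ i, t i = u}

/-- Semantics of first-order formulas on a database `D`, under a variable
assignment `σ`; quantifiers range over the active domain of `D`. -/
def FO.interp {S : Type} {ar : S → ℕ} {U : Type}
    (D : ∀ R : S, Set (Fin (ar R) → U)) : FO S ar → (ℕ → U) → Prop
  | .rel R v, σ => (fun i => σ (v i)) ∈ D R
  | .eq x y, σ => σ x = σ y
  | .not φ, σ => ¬ φ.interp D σ
  | .and φ ψ, σ => φ.interp D σ ∧ ψ.interp D σ
  | .or φ ψ, σ => φ.interp D σ ∨ ψ.interp D σ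
  | .ex y φ, σ => ∃ u ∈ adom D, φ.interp D (Function.update σ y u)

/-- Atomic formulas: relation atoms and equality atoms. -/
inductive FO.IsAtomic {S : Type} {ar : S → ℕ} : FO S ar → Prop
  | rel (R : S) (v : Fin (ar R) → ℕ) : (FO.rel R v).IsAtomic
  | eq (x y : ℕ) : (FO.eq (S := S) (ar := ar) x y).IsAtomic

/-- Quantifier-free formulas. -/
inductive FO.IsQF {S : Type} {ar : S → ℕ} : FO S ar → Prop
  | of_atomic {φ : FO S ar} : φ.IsAtomic → φ.IsQF
  | not {φ : FO S ar} : φ.IsQF → (FO.not φ).IsQF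
  | and {φ ψ : FO S ar} : φ.IsQF → ψ.IsQF → (FO.and φ ψ).IsQF
  | or {φ ψ : FO S ar} : φ.IsQF → ψ.IsQF → (FO.or φ ψ).IsQF

/-- Existentially quantify a list of variables. -/
def FO.exList {S : Type} {ar : S → ℕ} : List ℕ → FO S ar → FO S ar
  | [], φ => φ
  | y :: ys, φ => FO.ex y (FO.exList ys φ)

/-- The guarded fragment GF: quantifier-free formulas, Boolean combinations, and
guarded quantification `∃ȳ (α(x̄,ȳ) ∧ φ(x̄,ȳ))` where the guard `α` is an atomic
formula containing all free variables of `φ`. -/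
inductive FO.IsGF {S : Type} {ar : S → ℕ} : FO S ar → Prop
  | of_qf {φ : FO S ar} : φ.IsQF → φ.IsGF
  | not {φ : FO S ar} : φ.IsGF → (FO.not φ).IsGF
  | and {φ ψ : FO S ar} : φ.IsGF → ψ.IsGF → (FO.and φ ψ).IsGF
  | or {φ ψ : FO S ar} : φ.IsGF → ψ.IsGF → (FO.or φ ψ).IsGF
  | exG (ys : List ℕ) {α φ : FO S ar} :
      α.IsAtomic → φ.IsGF → φ.free ⊆ α.free →
      (FO.exList ys (FO.and α φ)).IsGF

namespace FO

variable {S : Type} {ar : S → ℕ} {U : Type}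

/-- An unsatisfiable guarded sentence. -/
def falsum : FO S ar := exList [0] (and (eq 0 0) (not (eq 0 0)))

theorem falsum_isGF : (falsum : FO S ar).IsGF :=
  .exG [0] (.eq 0 0) (.of_qf (.not (.of_atomic (.eq 0 0)))) subset_rfl

theorem falsum_free : (falsum : FO S ar).free = ∅ := by
  simp [falsum, exList, free]

theorem not_interp_falsum (D : ∀ R : S, Set (Fin (ar R) → U)) (σ : ℕ → U) :
    ¬ (falsum : FO S ar).interp D σ := by
  simp [falsum, exList, interp]

theorem free_exList (ys : List ℕ) (φ : FO S ar) :
    (exList ys φ).free = φ.free \ {y | y ∈ ys} := by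
  induction ys with
  | nil => simp [exList]
  | cons y ys ih =>
    ext x
    simp only [exList, free, ih, Set.mem_sdiff, Set.mem_ofPred_eq, Set.mem_singleton_iff,
      List.mem_cons]
    tauto

theorem interp_exList (D : ∀ R : S, Set (Fin (ar R) → U)) (ys : List ℕ) (φ : FO S ar)
    (σ : ℕ → U) :
    (exList ys φ).interp D σ ↔
      ∃ τ : ℕ → U, (∀ x ∉ ys, τ x = σ x) ∧ (∀ x ∈ ys, τ x ∈ adom D) ∧ φ.interp D τ := by
  induction ys generalizing σ with
  | nil =>
    constructor
    · exact fun h => ⟨σ, by simp, by simp, h⟩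
    · rintro ⟨τ, hτ, -, h⟩
      obtain rfl : τ = σ := funext fun x => hτ x (by simp)
      exact h
  | cons y ys ih =>
    simp only [exList, interp, ih]
    constructor
    · rintro ⟨u, hu, τ, hτ, hd, h⟩
      refine ⟨τ, fun x hx => ?_, fun x hx => ?_, h⟩
      · rw [List.mem_cons, not_or] at hx
        rw [hτ x hx.2, Function.update_of_ne hx.1]
      · by_cases hxs : x ∈ ys
        · exact hd x hxs
        · obtain rfl : x = y := by simpa [hxs] using hx
          rw [hτ x hxs, Function.update_self]
          exact hu
    · rintro ⟨τ, hτ, hd, h⟩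
      refine ⟨τ y, hd y (by simp), τ, fun x hx => ?_,
        fun x hx => hd x (List.mem_cons_of_mem _ hx), h⟩
      by_cases hxy : x = y
      · rw [hxy, Function.update_self]
      · rw [Function.update_of_ne hxy]
        exact hτ x (by simp [hxy, hx])

/-- The property `P` of a database and an assignment is expressed by a guarded formula with free
variables in `V`. -/
def Definable (V : Set ℕ) (P : (∀ R : S, Set (Fin (ar R) → U)) → (ℕ → U) → Prop) : Prop :=
  ∃ φ : FO S ar, φ.IsGF ∧ φ.free ⊆ V ∧ ∀ D σ, φ.interp D σ ↔ P D σ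

namespace Definable

variable {V : Set ℕ} {P Q : (∀ R : S, Set (Fin (ar R) → U)) → (ℕ → U) → Prop}

theorem not (hP : Definable V P) : Definable V fun D σ => ¬ P D σ := by
  obtain ⟨φ, hg, hf, h⟩ := hP
  exact ⟨.not φ, .not hg, hf, fun D σ => not_congr (h D σ)⟩

theorem and (hP : Definable V P) (hQ : Definable V Q) :
    Definable V fun D σ => P D σ ∧ Q D σ := by
  obtain ⟨φ, hg, hf, h⟩ := hP
  obtain ⟨ψ, hg', hf', h'⟩ := hQ
  exact ⟨.and φ ψ, .and hg hg', Set.union_subset hf hf',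
    fun D σ => and_congr (h D σ) (h' D σ)⟩

theorem or (hP : Definable V P) (hQ : Definable V Q) :
    Definable V fun D σ => P D σ ∨ Q D σ := by
  obtain ⟨φ, hg, hf, h⟩ := hP
  obtain ⟨ψ, hg', hf', h'⟩ := hQ
  exact ⟨.or φ ψ, .or hg hg', Set.union_subset hf hf',
    fun D σ => or_congr (h D σ) (h' D σ)⟩

theorem eq {x y : ℕ} (hx : x ∈ V) (hy : y ∈ V) :
    Definable V fun (_ : ∀ R : S, Set (Fin (ar R) → U)) σ => σ x = σ y :=
  ⟨.eq x y, .of_qf (.of_atomic (.eq x y)), Set.pair_subset hx hy, fun _ _ => Iff.rfl⟩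

theorem exists_mem_list {ι : Type} (L : List ι)
    {P : ι → (∀ R : S, Set (Fin (ar R) → U)) → (ℕ → U) → Prop}
    (hP : ∀ i ∈ L, Definable V (P i)) : Definable V fun D σ => ∃ i ∈ L, P i D σ := by
  induction L with
  | nil =>
    exact ⟨falsum, falsum_isGF, by simp [falsum_free],
      fun D σ => by simp [not_interp_falsum]⟩
  | cons i L ih =>
    simp only [List.mem_cons, exists_eq_or_imp]
    exact (hP i (by simp)).or (ih fun j hj => hP j (by simp [hj]))

theorem forall_mem_list {ι : Type} (L : List ι)
    {P : ι → (∀ R : S, Set (Fin (ar R) → U)) → (ℕ → U) → Prop}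
    (hP : ∀ i ∈ L, Definable V (P i)) : Definable V fun D σ => ∀ i ∈ L, P i D σ := by
  simpa using (exists_mem_list L fun i hi => (hP i hi).not).not

theorem eqForm {n : ℕ} (θ : EqForm n) (v : Fin n → ℕ) :
    Definable (Set.range v) fun (_ : ∀ R : S, Set (Fin (ar R) → U)) σ => θ.holds (σ ∘ v) := by
  unfold EqForm at θ
  unfold EqForm.holds
  induction θ with
  | atom p => exact p.elim
  | eq i j =>
    simpa only [QF.holds, Function.comp_apply] using
      Definable.eq (Set.mem_range_self i) (Set.mem_range_self j)
  | not φ ih => simpa only [QF.holds] using ih.not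
  | and φ ψ ih₁ ih₂ => simpa only [QF.holds] using ih₁.and ih₂
  | or φ ψ ih₁ ih₂ => simpa only [QF.holds] using ih₁.or ih₂

/-- Guarded quantification over the tuples of a relation, some of whose columns are required to
agree with given variables. -/
theorem exists_mem_rel (R : S) {n m : ℕ} (ρ : Fin m → Fin (ar R)) (θ : List (Fin n × Fin m))
    (v : Fin n → ℕ) {P : (∀ R : S, Set (Fin (ar R) → U)) → (Fin m → U) → Prop}
    (hP : ∀ w : Fin m → ℕ, Definable (Set.range w) fun D σ => P D (σ ∘ w)) :
    Definable (Set.range v) fun D σ =>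
      ∃ t ∈ D R, P D (t ∘ ρ) ∧ ∀ p ∈ θ, σ (v p.1) = t (ρ p.2) := by
  classical
  obtain ⟨M, hM⟩ : ∃ M, ∀ i, v i < M :=
    ⟨Finset.univ.sup v + 1, fun i => Nat.lt_succ_of_le (Finset.le_sup (Finset.mem_univ i))⟩
  let ys : List ℕ := (List.range (ar R)).map (M + ·)
  have v_notMem (i : Fin n) : v i ∉ ys := by
    have := hM i
    simp only [ys, List.mem_map, not_exists, not_and]
    omega
  obtain ⟨w, hw, hw'⟩ : ∃ w : Fin (ar R) → ℕ,
      (∀ p ∈ θ, ∃ q ∈ θ, ρ q.2 = ρ p.2 ∧ w (ρ p.2) = v q.1) ∧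
      ∀ c, (∃ q ∈ θ, ρ q.2 = c ∧ w c = v q.1) ∨ w c = M + c := by
    refine ⟨fun c => if h : ∃ q ∈ θ, ρ q.2 = c then v h.choose.1 else M + c,
      fun p hp => ?_, fun c => ?_⟩
    · have h : ∃ q ∈ θ, ρ q.2 = ρ p.2 := ⟨p, hp, rfl⟩
      exact ⟨h.choose, h.choose_spec.1, h.choose_spec.2, dif_pos h⟩
    · by_cases h : ∃ q ∈ θ, ρ q.2 = c
      · exact .inl ⟨h.choose, h.choose_spec.1, h.choose_spec.2, dif_pos h⟩
      · exact .inr (dif_neg h)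
  have mem_range {p} (hp : p ∈ θ) : w (ρ p.2) ∈ Set.range v := by
    obtain ⟨q, -, -, h⟩ := hw p hp
    exact ⟨q.1, h.symm⟩
  have hex : Definable (Set.range v) fun (D : ∀ R : S, Set (Fin (ar R) → U)) σ =>
      ∃ τ : ℕ → U, (∀ x ∉ ys, τ x = σ x) ∧ (∀ x ∈ ys, τ x ∈ adom D) ∧
        τ ∘ w ∈ D R ∧ P D (τ ∘ w ∘ ρ) := by
    obtain ⟨φ, hg, hf, h⟩ := hP (w ∘ ρ)
    have hfw : φ.free ⊆ (FO.rel (ar := ar) R w).free := hf.trans (Set.range_comp_subset_range ρ w)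
    refine ⟨exList ys (.and (.rel R w) φ), .exG ys (.rel R w) hg hfw, ?_, fun D σ => ?_⟩
    · rw [free_exList]
      rintro x ⟨hx, hxy⟩
      obtain ⟨c, rfl⟩ : x ∈ Set.range w := hx.elim id fun hx => hfw hx
      obtain ⟨q, -, -, hq⟩ | hc := hw' c
      · exact ⟨q.1, hq.symm⟩
      · exact absurd (by simp [ys, hc]) hxy
    · rw [interp_exList]
      simp only [interp, h]
      rfl
  obtain ⟨ψ, hg, hf, h⟩ :=
    (forall_mem_list θ fun p hp => eq (S := S) (ar := ar) (U := U) (Set.mem_range_self p.1)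
      (mem_range hp)).and hex
  refine ⟨ψ, hg, hf, fun D σ => (h D σ).trans ?_⟩
  constructor
  · rintro ⟨heq, τ, hτ, -, ht, hPt⟩
    refine ⟨τ ∘ w, ht, hPt, fun p hp => ?_⟩
    obtain ⟨i, hi⟩ := mem_range hp
    rw [heq p hp, Function.comp_apply, ← hi, hτ _ (v_notMem i)]
  · rintro ⟨t, ht, hPt, heq⟩
    refine ⟨fun p hp => ?_, fun x => if h : ∃ c : Fin (ar R), x = M + c then t h.choose else σ x,
      fun x hx => ?_, fun x hx => ?_, ?_⟩
    · obtain ⟨q, hq, hqp, h⟩ := hw p hp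
      rw [heq p hp, h, heq q hq, hqp]
    · refine dif_neg ?_
      rintro ⟨c, rfl⟩
      exact hx (by simp [ys])
    · beta_reduce
      have h : ∃ c : Fin (ar R), x = M + c := by
        obtain ⟨c, hc, rfl⟩ := List.mem_map.1 hx
        exact ⟨⟨c, List.mem_range.1 hc⟩, rfl⟩
      rw [dif_pos h]
      exact ⟨R, t, ht, h.choose, rfl⟩
    · rw [← Function.comp_assoc]
      generalize hτ : (fun x => if h : ∃ c : Fin (ar R), x = M + c then t h.choose else σ x) = τ
      have key : τ ∘ w = t := by
        funext c
        rw [← hτ]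
        obtain ⟨q, hq, rfl, h⟩ | h := hw' c
        · have hn : ¬ ∃ c : Fin (ar R), v q.1 = M + c := by
            rintro ⟨c, hc⟩
            have := hM q.1
            omega
          simp only [Function.comp_apply, h]
          rw [dif_neg hn, heq q hq]
        · have hc : ∃ c' : Fin (ar R), M + (c : ℕ) = M + c' := ⟨c, rfl⟩
          simp only [Function.comp_apply, h]
          rw [dif_pos hc]
          congr 1
          have := hc.choose_spec
          exact Fin.ext (by omega)
      rw [key]
      exact ⟨ht, hPt⟩

end Definable

end FO

namespace SAeq

variable {S : Type} {ar : S → ℕ} {U : Type}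

/-- Every tuple in the value of an SA= expression is a rearrangement of columns of a stored tuple,
in one of finitely many ways depending only on the expression. -/
theorem exists_guards {k : ℕ} (E : SAeq S ar k) :
    ∃ L : List (Σ R : S, Fin k → Fin (ar R)), ∀ D : ∀ R : S, Set (Fin (ar R) → U),
      ∀ a ∈ E.eval D, ∃ g ∈ L, ∃ t ∈ D g.1, a = t ∘ g.2 := by
  induction E with
  | rel R => exact ⟨[⟨R, id⟩], fun D a ha => ⟨_, List.mem_singleton_self _, a, ha, rfl⟩⟩
  | union E₁ E₂ ih₁ ih₂ =>
    obtain ⟨L₁, h₁⟩ := ih₁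
    obtain ⟨L₂, h₂⟩ := ih₂
    refine ⟨L₁ ++ L₂, fun D a ha => ?_⟩
    obtain ha | ha := ha
    · obtain ⟨g, hg, h⟩ := h₁ D a ha
      exact ⟨g, List.mem_append_left _ hg, h⟩
    · obtain ⟨g, hg, h⟩ := h₂ D a ha
      exact ⟨g, List.mem_append_right _ hg, h⟩
  | diff E₁ E₂ ih₁ ih₂ =>
    obtain ⟨L, h⟩ := ih₁
    exact ⟨L, fun D a ha => h D a ha.1⟩
  | proj f hf E ih =>
    obtain ⟨L, h⟩ := ih
    refine ⟨L.map fun g => ⟨g.1, g.2 ∘ f⟩, ?_⟩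
    rintro D _ ⟨a, ha, rfl⟩
    obtain ⟨g, hg, t, ht, rfl⟩ := h D a ha
    exact ⟨_, List.mem_map_of_mem hg, t, ht, rfl⟩
  | sel θ E ih =>
    obtain ⟨L, h⟩ := ih
    exact ⟨L, fun D a ha => h D a ha.1⟩
  | semijoin θ E₁ E₂ ih₁ ih₂ =>
    obtain ⟨L, h⟩ := ih₁
    exact ⟨L, fun D a ha => h D a ha.1⟩

theorem definable_exists_mem_eval {n m : ℕ} (E : SAeq S ar m)
    (hE : ∀ w : Fin m → ℕ, FO.Definable (U := U) (Set.range w) fun D σ => σ ∘ w ∈ E.eval D)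
    (θ : List (Fin n × Fin m)) (v : Fin n → ℕ) :
    FO.Definable (U := U) (Set.range v) fun D σ =>
      ∃ b ∈ E.eval D, ∀ p ∈ θ, (σ ∘ v) p.1 = b p.2 := by
  obtain ⟨L, hL⟩ := exists_guards (U := U) E
  obtain ⟨φ, hg, hf, h⟩ := FO.Definable.exists_mem_list L fun g _ =>
    FO.Definable.exists_mem_rel (U := U) g.1 g.2 θ v hE
  refine ⟨φ, hg, hf, fun D σ => (h D σ).trans ?_⟩
  constructor
  · rintro ⟨g, -, t, -, hb, heq⟩
    exact ⟨_, hb, heq⟩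
  · rintro ⟨b, hb, heq⟩
    obtain ⟨g, hg, t, ht, rfl⟩ := hL D b hb
    exact ⟨g, hg, t, ht, hb, heq⟩

theorem definable_mem_eval {k : ℕ} (E : SAeq S ar k) (v : Fin k → ℕ) :
    FO.Definable (U := U) (Set.range v) fun D σ => σ ∘ v ∈ E.eval D := by
  induction E with
  | rel R => exact ⟨.rel R v, .of_qf (.of_atomic (.rel R v)), subset_rfl, fun _ _ => Iff.rfl⟩
  | union E₁ E₂ ih₁ ih₂ => exact (ih₁ v).or (ih₂ v)
  | diff E₁ E₂ ih₁ ih₂ => exact (ih₁ v).and (ih₂ v).not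
  | proj f hf E ih =>
    obtain ⟨φ, hg, hfr, h⟩ :=
      definable_exists_mem_eval E ih ((List.finRange _).map fun j => (j, f j)) v
    refine ⟨φ, hg, hfr, fun D σ => (h D σ).trans ?_⟩
    simp [eval, funext_iff]
  | sel θ E ih => exact (ih v).and (.eqForm θ v)
  | semijoin θ E₁ E₂ ih₁ ih₂ => exact (ih₁ v).and (definable_exists_mem_eval E₂ ih₂ θ v)

end SAeq

/-- For every SA= expression `E` of arity `k` there is a formula
`φ_E` of the guarded fragment, with free variables among `x_0,…,x_(k-1)`, such that
on every database `D`, `E(D) = { d̄ ∈ U^k ∣ D ⊨ φ_E(d̄) }`. -/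
theorem stmt1 {U : Type} [Nonempty U] {S : Type} (ar : S → ℕ) {k : ℕ}
    (E : SAeq S ar k) :
    ∃ φ : FO S ar, φ.IsGF ∧ φ.free ⊆ {i : ℕ | i < k} ∧
      ∀ D : ∀ R : S, Set (Fin (ar R) → U), (∀ R : S, (D R).Finite) →
        ∀ d : Fin k → U,
          d ∈ E.eval D ↔ ∀ σ : ℕ → U, (∀ i : Fin k, σ i = d i) → φ.interp D σ := by
  obtain ⟨φ, hg, hf, h⟩ := SAeq.definable_mem_eval (U := U) E Fin.val
  refine ⟨φ, hg, fun x hx => ?_, fun D _ d => ?_⟩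
  · obtain ⟨i, rfl⟩ := hf hx
    exact i.2
  · constructor
    · intro hd σ hσ
      refine (h D σ).2 ?_
      beta_reduce
      rwa [show σ ∘ Fin.val = d from funext hσ]
    · intro hd
      obtain ⟨u⟩ := ‹Nonempty U›
      let σ : ℕ → U := fun x => if hx : x < k then d ⟨x, hx⟩ else u
      have hσ (i : Fin k) : σ i = d i := dif_pos i.2
      rw [← show σ ∘ Fin.val = d from funext hσ]
      exact (h D σ).1 (hd σ hσ)
end

section
/- The semijoin algebra SA≠ is not subsumed by the guarded fragment: over a schema with a single unary relation S, the SA≠ expression S ⋉_{x_1 ≠ y_1} S evaluates on a database D to a nonempty relation if and only if D(S) contains at least two distinct elements, whereas no GF sentence φ satisfies, for all databases D, D ⊨ φ iff D(S) has at least two distinct elements. -/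
/-- The semijoin algebra SA over a schema `S` (with arities `ar`) and vocabulary `Ω`
(with arities `ωar`, equality built in): expressions are built from relation names by
union and difference of equal-arity expressions, projection `π_X` (encoded by a
strictly monotone map of columns), selection `σ_θ`, and semijoin `E₁ ⋉_θ E₂`, where
selection and semijoin conditions `θ` are arbitrary quantifier-free formulas over
`Ω`. An expression is indexed by its arity. -/
inductive SA (S : Type) (ar : S → ℕ) (Ω : Type) (ωar : Ω → ℕ) : ℕ → Type
  | rel (R : S) : SA S ar Ω ωar (ar R)
  | union {n : ℕ} : SA S ar Ω ωar n → SA S ar Ω ωar n → SA S ar Ω ωar n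
  | diff {n : ℕ} : SA S ar Ω ωar n → SA S ar Ω ωar n → SA S ar Ω ωar n
  | proj {k n : ℕ} (f : Fin k → Fin n) (hf : StrictMono f) :
      SA S ar Ω ωar n → SA S ar Ω ωar k
  | sel {n : ℕ} (θ : QF Ω ωar n) : SA S ar Ω ωar n → SA S ar Ω ωar n
  | semijoin {n m : ℕ} (θ : QF Ω ωar (n + m)) :
      SA S ar Ω ωar n → SA S ar Ω ωar m → SA S ar Ω ωar n

/-- Evaluation of an SA expression on a database `D`, given an interpretation `I`
of the predicates of `Ω` over the universe `U`. In the semijoin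
`E₁ ⋉_θ E₂ = {ā ∈ E₁ ∣ ∃ b̄ ∈ E₂, θ(ā,b̄)}`, the condition `θ` is evaluated on the
concatenated tuple `(ā,b̄)`. -/
def SA.eval {S : Type} {ar : S → ℕ} {Ω : Type} {ωar : Ω → ℕ} {U : Type}
    (I : ∀ p : Ω, (Fin (ωar p) → U) → Prop)
    (D : ∀ R : S, Set (Fin (ar R) → U)) :
    ∀ {n : ℕ}, SA S ar Ω ωar n → Set (Fin n → U)
  | _, .rel R => D R
  | _, .union E₁ E₂ => SA.eval I D E₁ ∪ SA.eval I D E₂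
  | _, .diff E₁ E₂ => SA.eval I D E₁ \ SA.eval I D E₂
  | _, .proj f _ E => {t | ∃ a ∈ SA.eval I D E, t = a ∘ f}
  | _, .sel θ E => {a ∈ SA.eval I D E | QF.holds I θ a}
  | _, .semijoin θ E₁ E₂ =>
      {a ∈ SA.eval I D E₁ | ∃ b ∈ SA.eval I D E₂, QF.holds I θ (Fin.append a b)}
theorem FO.free_exList_s5 {S : Type} {ar : S → ℕ} (ys : List ℕ) (φ : FO S ar) :
    (FO.exList ys φ).free = φ.free \ {y | y ∈ ys} := by
  induction ys with
  | nil => simp [FO.exList]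
  | cons y ys ih =>
    ext x
    simp only [FO.exList, FO.free, ih, Set.mem_sdiff, Set.mem_ofPred_eq, Set.mem_singleton_iff,
      List.mem_cons]
    tauto

theorem FO.interp_exList_s5 {S : Type} {ar : S → ℕ} {U : Type}
    (D : ∀ R : S, Set (Fin (ar R) → U)) (ys : List ℕ) (φ : FO S ar) (σ : ℕ → U) :
    (FO.exList ys φ).interp D σ ↔
      ∃ τ : ℕ → U, (∀ x ∉ ys, τ x = σ x) ∧ (∀ x ∈ ys, τ x ∈ adom D) ∧ φ.interp D τ := by
  induction ys generalizing σ with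
  | nil =>
    constructor
    · exact fun h => ⟨σ, by simp, by simp, h⟩
    · rintro ⟨τ, hτ, -, h⟩
      obtain rfl : τ = σ := funext fun x => hτ x (by simp)
      exact h
  | cons y ys ih =>
    simp only [FO.exList, FO.interp, ih]
    constructor
    · rintro ⟨w, hw, τ, hτ, hys, h⟩
      refine ⟨τ, fun x hx => ?_, fun x hx => ?_, h⟩
      · rw [List.mem_cons, not_or] at hx
        rw [hτ x hx.2, Function.update_of_ne hx.1]
      · by_cases hx' : x ∈ ys
        · exact hys x hx'
        · obtain rfl : x = y := (List.mem_cons.1 hx).resolve_right hx'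
          rw [hτ x hx', Function.update_self]
          exact hw
    · rintro ⟨τ, hτ, hys, h⟩
      refine ⟨τ y, hys y (by simp), τ, fun x hx => ?_, fun x hx => hys x (by simp [hx]), h⟩
      by_cases hxy : x = y
      · rw [hxy, Function.update_self]
      · rw [Function.update_of_ne hxy, hτ x (by simp [hx, hxy])]

theorem const_mem_of_mem_adom {U : Type} {A : Set (Fin 1 → U)} {a : U}
    (h : a ∈ adom (S := Unit) (ar := fun _ => 1) (fun _ => A)) : (fun _ => a) ∈ A := by
  obtain ⟨_, t, ht, i, rfl⟩ := h
  rwa [show (fun _ => t i) = t from funext fun j => congrArg t (Subsingleton.elim (α := Fin 1) i j)]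

theorem mem_adom_of_const_mem {U : Type} {A : Set (Fin 1 → U)} {a : U} (h : (fun _ => a) ∈ A) :
    a ∈ adom (S := Unit) (ar := fun _ => 1) (fun _ => A) :=
  ⟨(), _, h, 0, rfl⟩

/-- Over a unary schema, an atomic formula holds whenever all its variables take one value
of the database. -/
theorem FO.IsAtomic.interp_of_const {U : Type} {A : Set (Fin 1 → U)} {a : U}
    (ha : (fun _ => a) ∈ A) {α : FO Unit (fun _ => 1)} (hα : α.IsAtomic) {σ : ℕ → U}
    (hσ : ∀ x ∈ α.free, σ x = a) : α.interp (fun _ => A) σ := by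
  cases hα with
  | rel R w =>
    have h : (fun i => σ (w i)) = fun _ => a := funext fun i => hσ _ ⟨i, rfl⟩
    simp only [FO.interp, h]
    exact ha
  | eq x y => exact (hσ x (by simp [FO.free])).trans (hσ y (by simp [FO.free])).symm

/-- Over a unary schema, the variables of a true atomic formula all take the same value. -/
theorem FO.IsAtomic.exists_const_of_interp {U : Type} {A : Set (Fin 1 → U)}
    {α : FO Unit (fun _ => 1)} (hα : α.IsAtomic) {σ : ℕ → U} (h : α.interp (fun _ => A) σ)
    (hA : ∀ x ∈ α.free, (fun _ => σ x) ∈ A) :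
    ∃ a, (fun _ => a) ∈ A ∧ ∀ x ∈ α.free, σ x = a := by
  cases hα with
  | rel R w =>
    refine ⟨σ (w 0), hA _ ⟨0, rfl⟩, ?_⟩
    rintro _ ⟨i, rfl⟩
    rw [Subsingleton.elim (α := Fin 1) i 0]
  | eq x y =>
    refine ⟨σ x, hA x (by simp [FO.free]), ?_⟩
    rintro z (rfl | rfl)
    · rfl
    · exact Eq.symm h

theorem FO.IsQF.interp_of_const {U : Type} {φ : FO Unit (fun _ => 1)} (hφ : φ.IsQF) :
    ∀ {A B : Set (Fin 1 → U)} {a b : U} {σ τ : ℕ → U}, (fun _ => a) ∈ A → (fun _ => b) ∈ B →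
      (∀ x ∈ φ.free, σ x = a) → (∀ x ∈ φ.free, τ x = b) →
      φ.interp (fun _ => A) σ → φ.interp (fun _ => B) τ := by
  induction hφ with
  | of_atomic hα => exact fun _ hb _ hτ _ => hα.interp_of_const hb hτ
  | not _ ih => exact fun ha hb hσ hτ h h' => h (ih hb ha hτ hσ h')
  | and _ _ ih₁ ih₂ =>
    exact fun ha hb hσ hτ =>
      And.imp (ih₁ ha hb (fun x hx => hσ x (.inl hx)) (fun x hx => hτ x (.inl hx)))
        (ih₂ ha hb (fun x hx => hσ x (.inr hx)) (fun x hx => hτ x (.inr hx)))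
  | or _ _ ih₁ ih₂ =>
    exact fun ha hb hσ hτ =>
      Or.imp (ih₁ ha hb (fun x hx => hσ x (.inl hx)) (fun x hx => hτ x (.inl hx)))
        (ih₂ ha hb (fun x hx => hσ x (.inr hx)) (fun x hx => hτ x (.inr hx)))

/-- Guarded formulas over a unary schema cannot distinguish two nonempty databases under
assignments that are constant on the free variables. -/
theorem FO.IsGF.interp_of_const {U : Type} {φ : FO Unit (fun _ => 1)} (hφ : φ.IsGF) :
    ∀ {A B : Set (Fin 1 → U)} {a b : U} {σ τ : ℕ → U}, (fun _ => a) ∈ A → (fun _ => b) ∈ B →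
      (∀ x ∈ φ.free, σ x = a) → (∀ x ∈ φ.free, τ x = b) →
      φ.interp (fun _ => A) σ → φ.interp (fun _ => B) τ := by
  induction hφ with
  | of_qf h => exact h.interp_of_const
  | not _ ih => exact fun ha hb hσ hτ h h' => h (ih hb ha hτ hσ h')
  | and _ _ ih₁ ih₂ =>
    exact fun ha hb hσ hτ =>
      And.imp (ih₁ ha hb (fun x hx => hσ x (.inl hx)) (fun x hx => hτ x (.inl hx)))
        (ih₂ ha hb (fun x hx => hσ x (.inr hx)) (fun x hx => hτ x (.inr hx)))
  | or _ _ ih₁ ih₂ =>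
    exact fun ha hb hσ hτ =>
      Or.imp (ih₁ ha hb (fun x hx => hσ x (.inl hx)) (fun x hx => hτ x (.inl hx)))
        (ih₂ ha hb (fun x hx => hσ x (.inr hx)) (fun x hx => hτ x (.inr hx)))
  | exG ys hα _ hfree ih =>
    intro A B a b σ τ ha hb hσ hτ h
    rw [FO.free_exList_s5] at hσ hτ
    rw [FO.interp_exList_s5] at h ⊢
    obtain ⟨ρ, hρ, hρA, hαρ, hφρ⟩ := h
    obtain ⟨c, hc, hρc⟩ := hα.exists_const_of_interp hαρ fun x hx => by
      by_cases hy : x ∈ ys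
      · exact const_mem_of_mem_adom (hρA x hy)
      · rw [hρ x hy, hσ x ⟨.inl hx, hy⟩]
        exact ha
    have hτb : ∀ x ∈ FO.free _, (if x ∈ ys then b else τ x) = b := fun x hx => by
      split_ifs with hy
      · rfl
      · exact hτ x ⟨.inl hx, hy⟩
    refine ⟨fun x => if x ∈ ys then b else τ x, fun x hx => if_neg hx, fun x hx => ?_,
      hα.interp_of_const hb hτb,
      ih hc hb (fun x hx => hρc x (hfree hx)) (fun x hx => hτb x (hfree hx)) hφρ⟩
    simpa only [if_pos hx] using mem_adom_of_const_mem hb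

/-- SA≠ is not subsumed by the guarded fragment. Over the schema with
a single unary relation name `S` and vocabulary `Ω = {=}` (encoded as `Ω = Empty`,
since equality is built in): the SA≠ expression `S ⋉_(x₁ ≠ y₁) S` evaluates on a
database `D` to a nonempty relation iff `D(S)` contains at least two distinct
elements, whereas no GF sentence `φ` satisfies, for all databases `D`, `D ⊨ φ` iff
`D(S)` has at least two distinct elements. -/
theorem stmt5 {U : Type} (u v : U) (huv : u ≠ v) :
    (∀ D : Set (Fin 1 → U), D.Finite →
      ((SA.semijoin (S := Unit) (ar := fun _ => 1) (Ω := Empty) (ωar := fun p => p.elim)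
          (QF.not (QF.eq (0 : Fin (1 + 1)) (1 : Fin (1 + 1))))
          (SA.rel ()) (SA.rel ())).eval
        (fun p => p.elim) (fun _ : Unit => D)).Nonempty ↔
      ∃ a ∈ D, ∃ b ∈ D, a ≠ b) ∧
    ¬ ∃ φ : FO Unit (fun _ => 1), φ.IsGF ∧ φ.free = ∅ ∧
        ∀ D : Set (Fin 1 → U), D.Finite →
          ((∀ σ : ℕ → U, φ.interp (fun _ : Unit => D) σ) ↔
            ∃ a ∈ D, ∃ b ∈ D, a ≠ b) := by
  refine ⟨fun D => ⟨fun h => ?_, ?_⟩, ?_⟩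
  · by_cases hD : D.Finite
    swap
    · obtain ⟨a, ha, b, hb, hab⟩ := Set.Infinite.nontrivial hD
      exact ⟨a, ha, b, hb, hab⟩
    obtain ⟨a, ha, b, hb, hab⟩ := h hD
    refine ⟨a, ha, b, hb, ?_⟩
    rintro rfl
    simp only [QF.holds] at hab
    exact hab rfl
  · rintro ⟨a, ha, b, hb, hab⟩ _
    refine ⟨a, ha, b, hb, ?_⟩
    simp only [QF.holds]
    refine fun h => hab (funext fun i => ?_)
    rw [Subsingleton.elim i 0]
    exact h
  · rintro ⟨φ, hφ, hfree, h⟩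
    have hpair : ∀ σ : ℕ → U,
        φ.interp (fun _ => ({fun _ => u, fun _ => v} : Set (Fin 1 → U))) σ :=
      (h _ (Set.toFinite _)).2
        ⟨_, .inl rfl, _, .inr rfl, fun he => huv (congrFun he 0)⟩
    obtain ⟨a, rfl, b, rfl, hab⟩ := (h {fun _ => u} (Set.toFinite _)).1 fun σ =>
      hφ.interp_of_const (.inl rfl) rfl (by simp [hfree]) (by simp [hfree]) (hpair σ)
    exact hab rfl
end

section
/- Finite satisfiability of SA≠ expressions is undecidable: there is no algorithm that, given an SA≠ expression E over a schema S, decides whether there exists a finite database D over S with E(D) ≠ ∅. -/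
/-- A numerical encoding of quantifier-free formulas over equality. -/
def EqForm.code : ∀ {n : ℕ}, EqForm n → ℕ
  | _, .atom p _ => p.elim
  | _, .eq i j => Nat.pair 0 (Nat.pair i.val j.val)
  | _, .not φ => Nat.pair 1 (EqForm.code φ)
  | _, .and φ ψ => Nat.pair 2 (Nat.pair (EqForm.code φ) (EqForm.code ψ))
  | _, .or φ ψ => Nat.pair 3 (Nat.pair (EqForm.code φ) (EqForm.code ψ))

/-- A numerical encoding of SA≠ expressions (SA expressions over the vocabulary
`Ω = {=}`, encoded as `Ω = Empty` since equality is built in) over a schema whose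
relation names are natural numbers. Each node records the arity of the expression,
a constructor tag, and codes of its components. -/
def SA.code {ar : ℕ → ℕ} : ∀ {n : ℕ}, SA ℕ ar Empty (fun p => p.elim) n → ℕ
  | _, .rel R => Nat.pair (ar R) (Nat.pair 0 R)
  | n, .union E₁ E₂ => Nat.pair n (Nat.pair 1 (Nat.pair E₁.code E₂.code))
  | n, .diff E₁ E₂ => Nat.pair n (Nat.pair 2 (Nat.pair E₁.code E₂.code))
  | n, .proj f _ E =>
      Nat.pair n (Nat.pair 3
        (Nat.pair (Encodable.encode (List.ofFn fun i => (f i).val)) E.code))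
  | n, .sel θ E => Nat.pair n (Nat.pair 4 (Nat.pair (EqForm.code θ) E.code))
  | n, .semijoin θ E₁ E₂ =>
      Nat.pair n (Nat.pair 5 (Nat.pair (EqForm.code θ) (Nat.pair E₁.code E₂.code)))

open Turing.ToPartrec (Code)

namespace SemijoinUndecidable

/-- Names of the relations used to describe runs of partial recursive programs: cells and
`nil` describe the data, `ev c` holds input-output pairs of `c`, and `loop c` holds
input-output pairs of the iteration of `c` together with the time of the iteration. -/
inductive RelName
  | cell
  | nil
  | ev (c : Code)
  | loop (c : Code)

/-- All relations are 8-ary. -/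
abbrev Tup : Type := Fin 8 → ℕ

/-- The tuples `a` and `b` agree on the listed pairs of columns. -/
def Matches : List (Fin 8 × Fin 8) → Tup → Tup → Prop
  | [], _, _ => True
  | p :: ps, a, b => a p.1 = b p.2 ∧ Matches ps a b

/-- Positive conditions on a single tuple. -/
inductive Cond
  | tru
  | ex (r : RelName) (ps : List (Fin 8 × Fin 8))
  | and (p q : Cond)
  | or (p q : Cond)

/-- Semantics of conditions. -/
def Cond.Sat (D : RelName → Set Tup) : Cond → Tup → Prop
  | tru, _ => True
  | ex r ps, t => ∃ s ∈ D r, Matches ps t s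
  | and p q, t => p.Sat D t ∧ q.Sat D t
  | or p q, t => p.Sat D t ∨ q.Sat D t

theorem Cond.Sat.mono {D D' : RelName → Set Tup} (h : ∀ r, D r ⊆ D' r) {q : Cond} {t : Tup}
    (hq : q.Sat D t) : q.Sat D' t := by
  induction q with
  | tru => trivial
  | ex r ps => obtain ⟨s, hs, hm⟩ := hq; exact ⟨s, h r hs, hm⟩
  | and p q hp hq' => exact ⟨hp hq.1, hq' hq.2⟩
  | or p q hp hq' => exact hq.imp hp hq'

/-! ### Data -/

/-- `x` denotes the empty list, or the number zero. -/
def IsNil (D : RelName → Set Tup) (x : ℕ) : Prop := ∃ s ∈ D .nil, x = s 0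

/-- `x` is a cell with first component `a` and second component `b`. -/
def IsCell (D : RelName → Set Tup) (x a b : ℕ) : Prop :=
  ∃ s ∈ D .cell, x = s 0 ∧ a = s 1 ∧ b = s 2

/-- `x` is a cell with second component `y`. -/
def IsSucc (D : RelName → Set Tup) (x y : ℕ) : Prop := ∃ s ∈ D .cell, x = s 0 ∧ y = s 2

/-- `h` is the head of `x`, defaulting to zero. -/
def IsHead (D : RelName → Set Tup) (x h : ℕ) : Prop :=
  (IsNil D x ∧ IsNil D h) ∨ ∃ s ∈ D .cell, x = s 0 ∧ h = s 1

/-- `y` is the tail of `x`, defaulting to the empty list. -/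
def IsTail (D : RelName → Set Tup) (x y : ℕ) : Prop :=
  (IsNil D x ∧ IsNil D y) ∨ IsSucc D x y

/-- `y` is recorded as an output of `c` on `x`. -/
def Evals (D : RelName → Set Tup) (c : Code) (x y : ℕ) : Prop :=
  ∃ s ∈ D (.ev c), x = s 0 ∧ y = s 1

/-- `y` is recorded as an output of the iteration of `c` from `x` at time `k`. -/
def Loops (D : RelName → Set Tup) (c : Code) (x y k : ℕ) : Prop :=
  ∃ s ∈ D (.loop c), x = s 0 ∧ y = s 1 ∧ k = s 2

namespace Cond

/-- The condition expressing `IsNil`. -/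
def isNil (i : Fin 8) : Cond := .ex .nil [(i, 0)]

/-- The condition expressing `IsCell`. -/
def isCell (i j k : Fin 8) : Cond := .ex .cell [(i, 0), (j, 1), (k, 2)]

/-- The condition expressing `IsSucc`. -/
def isSucc (i j : Fin 8) : Cond := .ex .cell [(i, 0), (j, 2)]

/-- The condition expressing `IsHead`. -/
def isHead (i j : Fin 8) : Cond :=
  .or (.and (isNil i) (isNil j)) (.ex .cell [(i, 0), (j, 1)])

/-- The condition expressing `IsTail`. -/
def isTail (i j : Fin 8) : Cond := .or (.and (isNil i) (isNil j)) (isSucc i j)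

/-- The condition expressing `Evals`. -/
def evals (c : Code) (i j : Fin 8) : Cond := .ex (.ev c) [(i, 0), (j, 1)]

/-- The condition expressing `Loops`. -/
def loops (c : Code) (i j k : Fin 8) : Cond := .ex (.loop c) [(i, 0), (j, 1), (k, 2)]

variable {D : RelName → Set Tup} {t : Tup}

@[simp] theorem sat_tru : tru.Sat D t ↔ True := Iff.rfl

@[simp] theorem sat_and {p q : Cond} : (and p q).Sat D t ↔ p.Sat D t ∧ q.Sat D t := Iff.rfl

@[simp] theorem sat_or {p q : Cond} : (or p q).Sat D t ↔ p.Sat D t ∨ q.Sat D t := Iff.rfl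

@[simp] theorem sat_isNil {i : Fin 8} : (isNil i).Sat D t ↔ IsNil D (t i) := by
  simp [isNil, Sat, IsNil, Matches]

@[simp] theorem sat_isCell {i j k : Fin 8} :
    (isCell i j k).Sat D t ↔ IsCell D (t i) (t j) (t k) := by
  simp [isCell, Sat, IsCell, Matches]

@[simp] theorem sat_isSucc {i j : Fin 8} : (isSucc i j).Sat D t ↔ IsSucc D (t i) (t j) := by
  simp [isSucc, Sat, IsSucc, Matches]

@[simp] theorem sat_isHead {i j : Fin 8} : (isHead i j).Sat D t ↔ IsHead D (t i) (t j) := by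
  simp [isHead, Sat, IsHead, Matches, isNil, IsNil]

@[simp] theorem sat_isTail {i j : Fin 8} : (isTail i j).Sat D t ↔ IsTail D (t i) (t j) := by
  simp [isTail, IsTail]

@[simp] theorem sat_evals {c : Code} {i j : Fin 8} :
    (evals c i j).Sat D t ↔ Evals D c (t i) (t j) := by
  simp [evals, Sat, Evals, Matches]

@[simp] theorem sat_loops {c : Code} {i j k : Fin 8} :
    (loops c i j k).Sat D t ↔ Loops D c (t i) (t j) (t k) := by
  simp [loops, Sat, Loops, Matches]

end Cond

open Cond in
/-- The condition that every tuple of the given relation must satisfy. -/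
def rule : RelName → Cond
  | .cell => .tru
  | .nil => .tru
  | .ev .zero' => .and (isCell 1 2 0) (isNil 2)
  | .ev .succ => .and (isHead 0 2) (.and (isSucc 3 2) (.and (isCell 1 3 4) (isNil 4)))
  | .ev .tail => isTail 0 1
  | .ev (.cons f fs) =>
    .and (evals f 0 2) (.and (isHead 2 3) (.and (evals fs 0 4) (isCell 1 3 4)))
  | .ev (.comp f g) => .and (evals g 0 2) (evals f 2 1)
  | .ev (.case f g) => .and (isHead 0 2) (.and (isTail 0 3) (.or
      (.and (isNil 2) (evals f 3 1))
      (.and (isSucc 2 4) (.and (isCell 5 4 3) (evals g 5 1)))))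
  | .ev (.fix f) => .and (isNil 2) (loops f 0 1 2)
  | .loop f => .and (evals f 0 4) (.and (isHead 4 5) (.and (isTail 4 6) (.or
      (.and (isNil 5) (isTail 4 1))
      (.and (isSucc 5 7) (.and (isSucc 3 2) (loops f 6 1 3))))))

/-- The relations on which the meaning of `ev c` depends. -/
def names : Code → List RelName
  | .zero' => [.ev .zero']
  | .succ => [.ev .succ]
  | .tail => [.ev .tail]
  | .cons f g => .ev (.cons f g) :: (names f ++ names g)
  | .comp f g => .ev (.comp f g) :: (names f ++ names g)
  | .case f g => .ev (.case f g) :: (names f ++ names g)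
  | .fix f => .ev (.fix f) :: .loop f :: names f

/-! ### Evaluation of programs -/

theorem mem_eval_cons {f g : Code} {l l' : List ℕ} : l' ∈ (Code.cons f g).eval l ↔
    ∃ u ∈ f.eval l, ∃ v ∈ g.eval l, l' = u.headI :: v := by
  rw [Code.cons_eval]
  simp only [Part.bind_eq_bind, Part.mem_bind_iff, Part.pure_eq_some, Part.mem_some_iff]

theorem mem_eval_comp {f g : Code} {l l' : List ℕ} : l' ∈ (Code.comp f g).eval l ↔
    ∃ u ∈ g.eval l, l' ∈ f.eval u := by
  rw [Code.comp_eval]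
  exact Part.mem_bind_iff

theorem mem_eval_fix {f : Code} {l l' : List ℕ} : l' ∈ (Code.fix f).eval l ↔
    ∃ u ∈ f.eval l, (u.headI = 0 ∧ l' = u.tail) ∨
      (u.headI ≠ 0 ∧ l' ∈ (Code.fix f).eval u.tail) := by
  rw [Code.fix_eval]
  constructor
  · intro h
    rcases PFun.mem_fix_iff.1 h with h | ⟨a, h, ha⟩
    · obtain ⟨u, hu, hul⟩ := (Part.mem_map_iff _).1 h
      refine ⟨u, hu, ?_⟩
      split_ifs at hul with h0
      exact Or.inl ⟨h0, (Sum.inl.inj hul).symm⟩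
    · obtain ⟨u, hu, hul⟩ := (Part.mem_map_iff _).1 h
      refine ⟨u, hu, ?_⟩
      split_ifs at hul with h0
      rw [Sum.inr.inj hul]
      exact Or.inr ⟨h0, ha⟩
  · rintro ⟨u, hu, ⟨h0, rfl⟩ | ⟨h0, h⟩⟩
    · exact PFun.mem_fix_iff.2 (Or.inl ((Part.mem_map_iff _).2 ⟨u, hu, by simp [h0]⟩))
    · exact PFun.mem_fix_iff.2
        (Or.inr ⟨_, (Part.mem_map_iff _).2 ⟨u, hu, by simp [h0]⟩, h⟩)

/-! ### Soundness -/

/-- Every object is the key of at most one cell, and of none if it is `nil`. -/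
def Coherent (D : RelName → Set Tup) : Prop :=
  (∀ s ∈ D .cell, ∀ t ∈ D .cell, s 0 = t 0 → s 1 = t 1 ∧ s 2 = t 2) ∧
    ∀ s ∈ D .cell, ∀ t ∈ D .nil, s 0 ≠ t 0

/-- The object `x` represents the number `n`. -/
def RepNat (D : RelName → Set Tup) (x : ℕ) : ℕ → Prop
  | 0 => IsNil D x
  | n + 1 => ∃ y, IsSucc D x y ∧ RepNat D y n

/-- The object `x` represents the list `l`. -/
def RepList (D : RelName → Set Tup) (x : ℕ) : List ℕ → Prop
  | [] => IsNil D x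
  | n :: l => ∃ y z, IsCell D x y z ∧ RepNat D y n ∧ RepList D z l

section Soundness

variable {D : RelName → Set Tup}

theorem IsCell.isSucc {x y z : ℕ} (h : IsCell D x y z) : IsSucc D x z := by
  obtain ⟨s, hs, h0, -, h2⟩ := h
  exact ⟨s, hs, h0, h2⟩

theorem Coherent.succ_unique (hD : Coherent D) {x y z : ℕ} (hy : IsSucc D x y)
    (hz : IsSucc D x z) : y = z := by
  obtain ⟨s, hs, rfl, rfl⟩ := hy
  obtain ⟨t, ht, h0, rfl⟩ := hz
  exact (hD.1 s hs t ht h0).2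

theorem Coherent.not_nil (hD : Coherent D) {x y : ℕ} (hy : IsSucc D x y) : ¬ IsNil D x := by
  obtain ⟨s, hs, rfl, -⟩ := hy
  rintro ⟨t, ht, h⟩
  exact hD.2 s hs t ht h

theorem Coherent.repNat_unique (hD : Coherent D) {x m n : ℕ} (hm : RepNat D x m)
    (hn : RepNat D x n) : m = n := by
  induction m generalizing x n with
  | zero =>
    cases n with
    | zero => rfl
    | succ n => obtain ⟨y, hy, -⟩ := hn; exact absurd hm (hD.not_nil hy)
  | succ m ih =>
    obtain ⟨y, hy, hym⟩ := hm
    cases n with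
    | zero => exact absurd hn (hD.not_nil hy)
    | succ n =>
      obtain ⟨z, hz, hzn⟩ := hn
      obtain rfl := hD.succ_unique hy hz
      rw [ih hym hzn]

theorem Coherent.repNat_pred (hD : Coherent D) {x y n : ℕ} (hx : RepNat D x n)
    (hy : IsSucc D x y) : ∃ m, n = m + 1 ∧ RepNat D y m := by
  cases n with
  | zero => exact absurd hx (hD.not_nil hy)
  | succ n =>
    obtain ⟨z, hz, hzn⟩ := hx
    obtain rfl := hD.succ_unique hy hz
    exact ⟨n, rfl, hzn⟩

theorem Coherent.repNat_head (hD : Coherent D) {x y : ℕ} {l : List ℕ} (hx : RepList D x l)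
    (hy : IsHead D x y) : RepNat D y l.headI := by
  cases l with
  | nil =>
    obtain ⟨-, h⟩ | ⟨s, hs, hxs, -⟩ := hy
    · exact h
    · exact absurd hx (hD.not_nil ⟨s, hs, hxs, rfl⟩)
  | cons n l =>
    obtain ⟨a, b, hab, ha, -⟩ := hx
    obtain ⟨h, -⟩ | ⟨s, hs, hxs, rfl⟩ := hy
    · exact absurd h (hD.not_nil hab.isSucc)
    · obtain ⟨t, ht, rfl, rfl, -⟩ := hab
      rw [← (hD.1 t ht s hs hxs).1]
      exact ha

theorem Coherent.repList_tail (hD : Coherent D) {x y : ℕ} {l : List ℕ} (hx : RepList D x l)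
    (hy : IsTail D x y) : RepList D y l.tail := by
  cases l with
  | nil =>
    obtain ⟨-, h⟩ | h := hy
    · exact h
    · exact absurd hx (hD.not_nil h)
  | cons n l =>
    obtain ⟨a, b, hab, -, hb⟩ := hx
    obtain ⟨h, -⟩ | h := hy
    · exact absurd h (hD.not_nil hab.isSucc)
    · rw [hD.succ_unique h hab.isSucc]
      exact hb

/-- Every recorded output of `c` on an input that represents a list is correct. -/
def Sound (D : RelName → Set Tup) (c : Code) : Prop :=
  ∀ x y l, Evals D c x y → RepList D x l → ∃ l' ∈ c.eval l, RepList D y l'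

theorem Coherent.exists_repNat_bound (hD : Coherent D) {A : Set Tup} (hA : A.Finite) :
    ∃ B, ∀ t ∈ A, ∀ k, RepNat D (t 2) k → k < B := by
  classical
  have hfin : {k | ∃ t ∈ A, RepNat D (t 2) k}.Finite := by
    refine (hA.image fun t => if h : ∃ k, RepNat D (t 2) k then h.choose else 0).subset ?_
    rintro k ⟨t, ht, hk⟩
    have h : ∃ k, RepNat D (t 2) k := ⟨k, hk⟩
    refine ⟨t, ht, ?_⟩
    simp only [dif_pos h]
    exact hD.repNat_unique h.choose_spec hk
  obtain ⟨B, hB⟩ := hfin.bddAbove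
  exact ⟨B + 1, fun t ht k hk => Nat.lt_succ_of_le (hB ⟨t, ht, hk⟩)⟩

theorem Coherent.loop_sound (hD : Coherent D) {f : Code} (hfin : (D (.loop f)).Finite)
    (hrule : ∀ t ∈ D (.loop f), (rule (.loop f)).Sat D t) (hf : Sound D f)
    {x y k n : ℕ} {l : List ℕ} (h : Loops D f x y k) (hk : RepNat D k n) (hl : RepList D x l) :
    ∃ l' ∈ (Code.fix f).eval l, RepList D y l' := by
  obtain ⟨B, hB⟩ := hD.exists_repNat_bound hfin
  induction hm : B - n using Nat.strong_induction_on generalizing x k n l with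
  | _ m ih =>
    obtain ⟨t, ht, rfl, rfl, rfl⟩ := h
    have hlt := hB t ht n hk
    obtain ⟨he, hh, htl, hor⟩ := by simpa [rule] using hrule t ht
    obtain ⟨u, hu, hul⟩ := hf _ _ _ he hl
    have hhd := hD.repNat_head hul hh
    obtain ⟨hz, ht1⟩ | ⟨hs, hs', hlp⟩ := hor
    · have h0 : u.headI = 0 := hD.repNat_unique hhd hz
      exact ⟨u.tail, mem_eval_fix.2 ⟨u, hu, Or.inl ⟨h0, rfl⟩⟩, hD.repList_tail hul ht1⟩
    · obtain ⟨p, hp, -⟩ := hD.repNat_pred hhd hs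
      obtain ⟨l', hl', hy⟩ := ih (B - (n + 1)) (by omega) (n := n + 1) hlp ⟨_, hs', hk⟩
        (hD.repList_tail hul htl) rfl
      exact ⟨l', mem_eval_fix.2 ⟨u, hu, Or.inr ⟨by simp [hp], hl'⟩⟩, hy⟩

theorem Coherent.sound (hD : Coherent D) (hfin : ∀ r, (D r).Finite) (c : Code)
    (hrule : ∀ r ∈ names c, ∀ t ∈ D r, (rule r).Sat D t) : Sound D c := by
  induction c with
  | zero' =>
    rintro x y l ⟨t, ht, rfl, rfl⟩ hl
    obtain ⟨h1, h2⟩ := by simpa [rule] using hrule (.ev .zero') (by simp [names]) t ht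
    exact ⟨0 :: l, by simp, _, _, h1, h2, hl⟩
  | succ =>
    rintro x y l ⟨t, ht, rfl, rfl⟩ hl
    obtain ⟨h1, h2, h3, h4⟩ := by simpa [rule] using hrule (.ev .succ) (by simp [names]) t ht
    exact ⟨[l.headI + 1], by simp, _, _, h3, ⟨_, h2, hD.repNat_head hl h1⟩, h4⟩
  | tail =>
    rintro x y l ⟨t, ht, rfl, rfl⟩ hl
    have h := by simpa [rule] using hrule (.ev .tail) (by simp [names]) t ht
    exact ⟨l.tail, by simp, hD.repList_tail hl h⟩
  | cons f g ihf ihg =>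
    rintro x y l ⟨t, ht, rfl, rfl⟩ hl
    obtain ⟨h1, h2, h3, h4⟩ := by
      simpa [rule] using hrule (.ev (.cons f g)) (by simp [names]) t ht
    obtain ⟨u, hu, hul⟩ := ihf (fun r hr => hrule r (by simp [names, hr])) _ _ _ h1 hl
    obtain ⟨v, hv, hvl⟩ := ihg (fun r hr => hrule r (by simp [names, hr])) _ _ _ h3 hl
    exact ⟨u.headI :: v, mem_eval_cons.2 ⟨u, hu, v, hv, rfl⟩, _, _, h4,
      hD.repNat_head hul h2, hvl⟩
  | comp f g ihf ihg =>
    rintro x y l ⟨t, ht, rfl, rfl⟩ hl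
    obtain ⟨h1, h2⟩ := by
      simpa [rule] using hrule (.ev (.comp f g)) (by simp [names]) t ht
    obtain ⟨u, hu, hul⟩ := ihg (fun r hr => hrule r (by simp [names, hr])) _ _ _ h1 hl
    obtain ⟨v, hv, hvl⟩ := ihf (fun r hr => hrule r (by simp [names, hr])) _ _ _ h2 hul
    exact ⟨v, mem_eval_comp.2 ⟨u, hu, hv⟩, hvl⟩
  | case f g ihf ihg =>
    rintro x y l ⟨t, ht, rfl, rfl⟩ hl
    obtain ⟨h1, h2, h3⟩ := by
      simpa [rule] using hrule (.ev (.case f g)) (by simp [names]) t ht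
    have hhd := hD.repNat_head hl h1
    have htl := hD.repList_tail hl h2
    obtain ⟨hz, he⟩ | ⟨hs, hc, he⟩ := h3
    · have h0 : l.headI = 0 := hD.repNat_unique hhd hz
      obtain ⟨u, hu, hul⟩ := ihf (fun r hr => hrule r (by simp [names, hr])) _ _ _ he htl
      exact ⟨u, by simpa [h0] using hu, hul⟩
    · obtain ⟨p, hp, hpr⟩ := hD.repNat_pred hhd hs
      obtain ⟨u, hu, hul⟩ := ihg (fun r hr => hrule r (by simp [names, hr])) _ _ (p :: l.tail) he
        ⟨_, _, hc, hpr, htl⟩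
      exact ⟨u, by simpa [hp] using hu, hul⟩
  | fix f ih =>
    rintro x y l ⟨t, ht, rfl, rfl⟩ hl
    obtain ⟨h1, h2⟩ := by
      simpa [rule] using hrule (.ev (.fix f)) (by simp [names]) t ht
    exact hD.loop_sound (hfin _) (hrule _ (by simp [names]))
      (ih fun r hr => hrule r (by simp [names, hr])) h2 (n := 0) h1 hl

end Soundness

/-! ### Completeness -/

/-- The object denoting a number. -/
def encNat (n : ℕ) : ℕ := 2 * n

/-- The object denoting a list. -/
def encList (l : List ℕ) : ℕ := 2 * Encodable.encode l + 1

theorem encNat_inj {m n : ℕ} : encNat m = encNat n ↔ m = n := by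
  unfold encNat; omega

theorem encList_inj {l l' : List ℕ} : encList l = encList l' ↔ l = l' := by
  rw [← Encodable.encode_inj (a := l)]
  unfold encList; omega

theorem encNat_ne_encList {n : ℕ} {l : List ℕ} : encNat n ≠ encList l := by
  unfold encNat encList; omega

/-- Correctness of a tuple describing data; no restriction on the other relations. -/
def TrueFact : RelName → Tup → Prop
  | .cell, t => (∃ n, t 0 = encNat (n + 1) ∧ t 1 = encNat 0 ∧ t 2 = encNat n) ∨
      ∃ n l, t 0 = encList (n :: l) ∧ t 1 = encNat n ∧ t 2 = encList l
  | .nil, t => t 0 = encNat 0 ∨ t 0 = encList []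
  | _, _ => True

theorem coherent_of_trueFact {D : RelName → Set Tup} (hD : ∀ r, ∀ t ∈ D r, TrueFact r t) :
    Coherent D := by
  constructor
  · intro s hs t ht h
    obtain ⟨m, h0, h1, h2⟩ | ⟨m, l, h0, h1, h2⟩ := hD _ _ hs <;>
    obtain ⟨n, k0, k1, k2⟩ | ⟨n, l', k0, k1, k2⟩ := hD _ _ ht <;>
    rw [h0, k0] at h
    · have := encNat_inj.1 h
      rw [h1, h2, k1, k2]
      exact ⟨rfl, encNat_inj.2 (by omega)⟩
    · exact absurd h encNat_ne_encList
    · exact absurd h.symm encNat_ne_encList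
    · obtain ⟨rfl, rfl⟩ := List.cons.inj (encList_inj.1 h)
      rw [h1, h2, k1, k2]
      exact ⟨rfl, rfl⟩
  · intro s hs t ht h
    obtain ⟨m, h0, -⟩ | ⟨m, l, h0, -⟩ := hD _ _ hs <;>
    obtain k0 | k0 := hD _ _ ht <;>
    rw [h0, k0] at h
    · exact absurd (encNat_inj.1 h) (by omega)
    · exact encNat_ne_encList h
    · exact encNat_ne_encList h.symm
    · exact absurd (encList_inj.1 h) (by simp)

/-- The database described by a set of facts. -/
def facts (F : Set (RelName × Tup)) (r : RelName) : Set Tup := {t | (r, t) ∈ F}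

/-- A finite set of correct facts in which every tuple satisfies its rule. -/
structure Supported (F : Set (RelName × Tup)) : Prop where
  finite : F.Finite
  trueFact : ∀ r, ∀ t ∈ facts F r, TrueFact r t
  rule : ∀ r, ∀ t ∈ facts F r, (rule r).Sat (facts F) t

theorem Supported.union {F G : Set (RelName × Tup)} (hF : Supported F) (hG : Supported G) :
    Supported (F ∪ G) where
  finite := hF.finite.union hG.finite
  trueFact r t ht := ht.elim (hF.trueFact r t) (hG.trueFact r t)
  rule r t ht := ht.elim
    (fun h => (hF.rule r t h).mono fun _ _ => Or.inl)
    (fun h => (hG.rule r t h).mono fun _ _ => Or.inr)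

/-- The facts that belong to some supported set of facts. -/
def derivable (r : RelName) : Set Tup := {t | ∃ F, Supported F ∧ t ∈ facts F r}

theorem exists_supported_of_sat {q : Cond} {t : Tup} (h : q.Sat derivable t) :
    ∃ F, Supported F ∧ q.Sat (facts F) t := by
  induction q with
  | tru => exact ⟨∅, ⟨Set.finite_empty, fun _ _ h => h.elim, fun _ _ h => h.elim⟩, trivial⟩
  | ex r ps =>
    obtain ⟨s, ⟨F, hF, hs⟩, hm⟩ := h
    exact ⟨F, hF, s, hs, hm⟩
  | and p q hp hq =>
    obtain ⟨F, hF, hFp⟩ := hp h.1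
    obtain ⟨G, hG, hGq⟩ := hq h.2
    exact ⟨F ∪ G, hF.union hG, hFp.mono fun _ _ => Or.inl, hGq.mono fun _ _ => Or.inr⟩
  | or p q hp hq =>
    rcases h with h | h
    · obtain ⟨F, hF, hFp⟩ := hp h
      exact ⟨F, hF, Or.inl hFp⟩
    · obtain ⟨F, hF, hFq⟩ := hq h
      exact ⟨F, hF, Or.inr hFq⟩

theorem mem_derivable {r : RelName} {t : Tup} (ht : TrueFact r t)
    (h : (rule r).Sat derivable t) : t ∈ derivable r := by
  obtain ⟨F, hF, hFt⟩ := exists_supported_of_sat h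
  refine ⟨insert (r, t) F, ⟨hF.finite.insert _, ?_, ?_⟩, Or.inl rfl⟩
  · rintro r' t' (h' | h')
    · cases h'; exact ht
    · exact hF.trueFact _ _ h'
  · rintro r' t' (h' | h')
    · cases h'; exact hFt.mono fun _ _ => Or.inr
    · exact (hF.rule _ _ h').mono fun _ _ => Or.inr

theorem isNil_encNat : IsNil derivable (encNat 0) :=
  ⟨fun _ => encNat 0, mem_derivable (Or.inl rfl) trivial, rfl⟩

theorem isNil_encList : IsNil derivable (encList []) :=
  ⟨fun _ => encList [], mem_derivable (Or.inr rfl) trivial, rfl⟩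

theorem isSucc_encNat (n : ℕ) : IsSucc derivable (encNat (n + 1)) (encNat n) :=
  ⟨![encNat (n + 1), encNat 0, encNat n, 0, 0, 0, 0, 0],
    mem_derivable (Or.inl ⟨n, rfl, rfl, rfl⟩) trivial, rfl, rfl⟩

theorem isCell_encList (n : ℕ) (l : List ℕ) :
    IsCell derivable (encList (n :: l)) (encNat n) (encList l) :=
  ⟨![encList (n :: l), encNat n, encList l, 0, 0, 0, 0, 0],
    mem_derivable (Or.inr ⟨n, l, rfl, rfl, rfl⟩) trivial, rfl, rfl, rfl⟩

theorem isHead_encList (l : List ℕ) : IsHead derivable (encList l) (encNat l.headI) := by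
  cases l with
  | nil => exact Or.inl ⟨isNil_encList, isNil_encNat⟩
  | cons n l =>
    obtain ⟨s, hs, h0, h1, -⟩ := isCell_encList n l
    exact Or.inr ⟨s, hs, h0, h1⟩

theorem isTail_encList (l : List ℕ) : IsTail derivable (encList l) (encList l.tail) := by
  cases l with
  | nil => exact Or.inl ⟨isNil_encList, isNil_encList⟩
  | cons n l => exact Or.inr (isCell_encList n l).isSucc

theorem evals_of_sat {c : Code} (t : Tup) (h : (rule (.ev c)).Sat derivable t) :
    Evals derivable c (t 0) (t 1) :=
  ⟨t, mem_derivable trivial h, rfl, rfl⟩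

theorem loops_of_sat {c : Code} (t : Tup) (h : (rule (.loop c)).Sat derivable t) :
    Loops derivable c (t 0) (t 1) (t 2) :=
  ⟨t, mem_derivable trivial h, rfl, rfl, rfl⟩

theorem loops_of_mem_eval {f : Code}
    (hf : ∀ l l', l' ∈ f.eval l → Evals derivable f (encList l) (encList l'))
    {l l' : List ℕ} (h : l' ∈ (Code.fix f).eval l) (k : ℕ) :
    Loops derivable f (encList l) (encList l') (encNat k) := by
  have key : ∀ l, l' ∈ (Code.fix f).eval l →
      (∀ u ∈ f.eval l, u.headI ≠ 0 → ∀ k,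
        Loops derivable f (encList u.tail) (encList l') (encNat k)) →
      ∀ k, Loops derivable f (encList l) (encList l') (encNat k) := by
    intro l hl ih k
    obtain ⟨u, hu, hor⟩ := mem_eval_fix.1 hl
    refine loops_of_sat ![encList l, encList l', encNat k, encNat (k + 1), encList u,
      encNat u.headI, encList u.tail, encNat u.headI.pred] ?_
    obtain ⟨h0, rfl⟩ | ⟨h0, h⟩ := hor
    · have := isHead_encList u
      rw [h0] at this
      simp [rule, hf l u hu, isTail_encList, h0, isNil_encNat, this]
    · obtain ⟨p, hp⟩ := Nat.exists_eq_succ_of_ne_zero h0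
      have hhd := isHead_encList u
      have hl := ih u hu h0 (k + 1)
      rw [hp] at hhd
      simp [rule, hf l u hu, isTail_encList, hp, hhd, isSucc_encNat, hl]
  rw [Code.fix_eval] at h
  refine PFun.fixInduction (C := fun l => ∀ k, Loops derivable f (encList l) (encList l') (encNat k)) h
    (fun a ha ih => ?_) k
  ·
    rw [← Code.fix_eval] at ha
    refine key a ha fun u hu h0 k => ih u.tail ?_ k
    exact (Part.mem_map_iff _).2 ⟨u, hu, by simp [h0]⟩

theorem evals_of_mem_eval {c : Code} {l l' : List ℕ} (h : l' ∈ c.eval l) :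
    Evals derivable c (encList l) (encList l') := by
  induction c generalizing l l' with
  | zero' =>
    obtain rfl : l' = 0 :: l := by simpa using h
    refine evals_of_sat ![encList l, encList (0 :: l), encNat 0, 0, 0, 0, 0, 0] ?_
    simp [rule, isCell_encList, isNil_encNat]
  | succ =>
    obtain rfl : l' = [l.headI + 1] := by simpa using h
    refine evals_of_sat ![encList l, encList [l.headI + 1], encNat l.headI,
      encNat (l.headI + 1), encList [], 0, 0, 0] ?_
    simp [rule, isCell_encList, isNil_encList, isHead_encList, isSucc_encNat]
  | tail =>
    obtain rfl : l' = l.tail := by simpa using h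
    refine evals_of_sat ![encList l, encList l.tail, 0, 0, 0, 0, 0, 0] ?_
    simp [rule, isTail_encList]
  | cons f g ihf ihg =>
    obtain ⟨u, hu, v, hv, rfl⟩ := mem_eval_cons.1 h
    refine evals_of_sat ![encList l, encList (u.headI :: v), encList u, encNat u.headI,
      encList v, 0, 0, 0] ?_
    simp [rule, isCell_encList, isHead_encList, ihf hu, ihg hv]
  | comp f g ihf ihg =>
    obtain ⟨u, hu, hv⟩ := mem_eval_comp.1 h
    refine evals_of_sat ![encList l, encList l', encList u, 0, 0, 0, 0, 0] ?_
    simp [rule, ihg hu, ihf hv]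
  | case f g ihf ihg =>
    have hhd := isHead_encList l
    have htl := isTail_encList l
    rw [Code.case_eval] at h
    generalize hn : l.headI = n at h hhd
    cases n with
    | zero =>
      refine evals_of_sat ![encList l, encList l', encNat 0, encList l.tail, 0, 0, 0, 0] ?_
      simp [rule, hhd, htl, isNil_encNat, ihf (l := l.tail) (by simpa [hn] using h)]
    | succ p =>
      refine evals_of_sat ![encList l, encList l', encNat (p + 1), encList l.tail, encNat p,
        encList (p :: l.tail), 0, 0] ?_
      simp [rule, hhd, htl, isSucc_encNat, isCell_encList,
        ihg (l := p :: l.tail) (by simpa [hn] using h)]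
  | fix f ih =>
    refine evals_of_sat ![encList l, encList l', encNat 0, 0, 0, 0, 0, 0] ?_
    simp [rule, isNil_encNat, loops_of_mem_eval (fun _ _ => ih) h 0]

theorem RepNat.mono {D D' : RelName → Set Tup} (h : ∀ r, D r ⊆ D' r) {x n : ℕ}
    (hx : RepNat D x n) : RepNat D' x n := by
  induction n generalizing x with
  | zero => exact hx.imp fun _ => And.imp_left (h _ ·)
  | succ n ih =>
    obtain ⟨y, hy, hn⟩ := hx
    exact ⟨y, hy.imp fun _ => And.imp_left (h _ ·), ih hn⟩

theorem exists_supported_repNat (n : ℕ) :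
    ∃ F, Supported F ∧ RepNat (facts F) (encNat n) n := by
  induction n with
  | zero =>
    obtain ⟨s, ⟨F, hF, hs⟩, h⟩ := isNil_encNat
    exact ⟨F, hF, s, hs, h⟩
  | succ n ih =>
    obtain ⟨G, hG, hn⟩ := ih
    obtain ⟨s, ⟨F, hF, hs⟩, h⟩ := isSucc_encNat n
    exact ⟨F ∪ G, hF.union hG, _, ⟨s, Or.inl hs, h⟩, hn.mono fun _ _ => Or.inr⟩

theorem exists_supported_run {c : Code} {n : ℕ} {l : List ℕ} (h : l ∈ c.eval [n]) :
    ∃ F, Supported F ∧ Evals (facts F) c (encList [n]) (encList l) ∧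
      RepList (facts F) (encList [n]) [n] := by
  obtain ⟨s₁, ⟨F₁, hF₁, hs₁⟩, h₁⟩ := evals_of_mem_eval h
  obtain ⟨s₂, ⟨F₂, hF₂, hs₂⟩, h₂⟩ := isCell_encList n []
  obtain ⟨s₃, ⟨F₃, hF₃, hs₃⟩, h₃⟩ := isNil_encList
  obtain ⟨F₄, hF₄, hn⟩ := exists_supported_repNat n
  exact ⟨F₁ ∪ (F₂ ∪ (F₃ ∪ F₄)), hF₁.union (hF₂.union (hF₃.union hF₄)),
    ⟨s₁, Or.inl hs₁, h₁⟩, _, _, ⟨s₂, Or.inr (Or.inl hs₂), h₂⟩,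
    hn.mono fun _ _ h => Or.inr (Or.inr (Or.inr h)),
    ⟨s₃, Or.inr (Or.inr (Or.inl hs₃)), h₃⟩⟩

/-! ### Translation into the semijoin algebra -/

/-- A numerical encoding of programs. -/
def codeNum : Code → ℕ
  | .zero' => Nat.pair 0 0
  | .succ => Nat.pair 1 0
  | .tail => Nat.pair 2 0
  | .cons f g => Nat.pair 3 (Nat.pair (codeNum f) (codeNum g))
  | .comp f g => Nat.pair 4 (Nat.pair (codeNum f) (codeNum g))
  | .case f g => Nat.pair 5 (Nat.pair (codeNum f) (codeNum g))
  | .fix f => Nat.pair 6 (codeNum f)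

theorem codeNum_injective : Function.Injective codeNum := by
  intro c
  induction c with
  | zero' | succ | tail => intro d h; cases d <;> simp [codeNum, Nat.pair_eq_pair] at h ⊢
  | cons f g ihf ihg | comp f g ihf ihg | case f g ihf ihg =>
    intro d h
    cases d <;> simp only [codeNum, Nat.pair_eq_pair] at h <;> first
      | (exfalso; omega)
      | rw [ihf h.2.1, ihg h.2.2]
  | fix f ih =>
    intro d h
    cases d <;> simp only [codeNum, Nat.pair_eq_pair] at h <;> first
      | (exfalso; omega)
      | rw [ih h.2]

/-- The number used as the name of a relation in the schema. -/
def RelName.num : RelName → ℕ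
  | cell => Nat.pair 0 0
  | nil => Nat.pair 1 0
  | ev c => Nat.pair 2 (codeNum c)
  | loop c => Nat.pair 3 (codeNum c)

theorem RelName.num_injective : Function.Injective num := by
  intro r s h
  cases r <;> cases s <;> simp [num, Nat.pair_eq_pair, codeNum_injective.eq_iff] at h ⊢ <;> exact h

/-- Expressions of arity 8 over a schema in which all relations have arity 8. -/
abbrev Expr : Type := SA ℕ (fun _ => 8) Empty (fun p => p.elim) 8

/-- The relation name `r`, as an expression. -/
def rel (r : RelName) : Expr := SA.rel r.num

/-- The result of `E` on the database `D`. -/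
def Holds (D : ℕ → Set Tup) (E : Expr) : Set Tup := E.eval (fun p => p.elim) D

/-- The formula stating that two tuples agree on the listed pairs of columns. -/
def matchForm : List (Fin 8 × Fin 8) → EqForm (8 + 8)
  | [] => .eq 0 0
  | p :: ps => .and (.eq (Fin.castAdd 8 p.1) (Fin.natAdd 8 p.2)) (matchForm ps)

theorem holds_matchForm {ps : List (Fin 8 × Fin 8)} {a b : Tup} :
    QF.holds (fun p => p.elim) (matchForm ps) (Fin.append a b) ↔ Matches ps a b := by
  induction ps with
  | nil => simp [matchForm, QF.holds, Matches]
  | cons p ps ih => simp only [matchForm, QF.holds, Matches, ih, Fin.append_left, Fin.append_right]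

/-- The semijoin of two expressions on equality of the listed pairs of columns. -/
def join (ps : List (Fin 8 × Fin 8)) (E F : Expr) : Expr := .semijoin (matchForm ps) E F

section Eval

variable {D : ℕ → Set Tup} {t : Tup}

theorem mem_rel {r : RelName} : t ∈ Holds D (rel r) ↔ t ∈ D r.num := Iff.rfl

theorem mem_union {E F : Expr} : t ∈ Holds D (.union E F) ↔ t ∈ Holds D E ∨ t ∈ Holds D F :=
  Iff.rfl

theorem mem_diff {E F : Expr} : t ∈ Holds D (.diff E F) ↔ t ∈ Holds D E ∧ t ∉ Holds D F :=
  Iff.rfl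

theorem mem_semijoin {θ : EqForm (8 + 8)} {E F : Expr} : t ∈ Holds D (.semijoin θ E F) ↔
    t ∈ Holds D E ∧ ∃ s ∈ Holds D F, QF.holds (fun p => p.elim) θ (Fin.append t s) :=
  Iff.rfl

theorem mem_join {ps : List (Fin 8 × Fin 8)} {E F : Expr} :
    t ∈ Holds D (join ps E F) ↔ t ∈ Holds D E ∧ ∃ s ∈ Holds D F, Matches ps t s := by
  simp only [join, mem_semijoin, holds_matchForm]

/-- The expression that selects the tuples of `E` that satisfy a condition. -/
def Cond.filter : Cond → Expr → Expr
  | tru, E => E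
  | ex r ps, E => join ps E (rel r)
  | and p q, E => q.filter (p.filter E)
  | or p q, E => .union (p.filter E) (q.filter E)

theorem Cond.mem_filter {q : Cond} {E : Expr} :
    t ∈ Holds D (q.filter E) ↔ t ∈ Holds D E ∧ q.Sat (fun r => D r.num) t := by
  induction q generalizing E with
  | tru => simp [filter]
  | ex r ps => exact mem_join
  | and p q hp hq => rw [filter, hq, hp, and_assoc]; rfl
  | or p q hp hq => rw [filter, mem_union, hp, hq, ← and_or_left]; rfl

/-- The formula stating that two tuples agree on the first column but not on the next two. -/
def clashForm : EqForm (8 + 8) :=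
  .and (matchForm [(0, 0)]) (.not (matchForm [(1, 1), (2, 2)]))

/-- The tuples that witness a violation of `Coherent`. -/
def clash : Expr :=
  .union (.semijoin clashForm (rel .cell) (rel .cell)) (join [(0, 0)] (rel .cell) (rel .nil))

theorem clash_eq_empty : Holds D clash = ∅ ↔ Coherent fun r => D r.num := by
  have h1 : ∀ t, t ∈ Holds D (.semijoin clashForm (rel .cell) (rel .cell)) ↔
      t ∈ D (RelName.cell.num) ∧ ∃ s ∈ D (RelName.cell.num),
        Matches [(0, 0)] t s ∧ ¬ Matches [(1, 1), (2, 2)] t s := by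
    intro t
    simp only [mem_semijoin, mem_rel, clashForm, QF.holds, holds_matchForm]
  simp only [Set.eq_empty_iff_forall_notMem, clash, mem_union, h1, mem_join, mem_rel, Coherent,
    Matches, and_true]
  constructor
  · intro h
    refine ⟨fun t ht s hs h0 => ?_, fun t ht s hs h0 => h t (Or.inr ⟨ht, s, hs, h0⟩)⟩
    by_contra hne
    exact h t (Or.inl ⟨ht, s, hs, h0, hne⟩)
  · rintro ⟨ha, hb⟩ t (⟨ht, s, hs, h0, hne⟩ | ⟨ht, s, hs, h0⟩)
    · exact hne (ha t ht s hs h0)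
    · exact hb t ht s hs h0

/-- The tuples that witness a violation of `Coherent` or of one of the given rules. -/
def violations : List RelName → Expr
  | [] => clash
  | r :: rs => .union (.diff (rel r) ((rule r).filter (rel r))) (violations rs)

theorem violations_eq_empty {rs : List RelName} : Holds D (violations rs) = ∅ ↔
    (Coherent fun r => D r.num) ∧
      ∀ r ∈ rs, ∀ t ∈ D r.num, (rule r).Sat (fun r => D r.num) t := by
  induction rs with
  | nil => simp [violations, clash_eq_empty]
  | cons r rs ih =>
    have h : Holds D (violations (r :: rs)) =
        Holds D (.diff (rel r) ((rule r).filter (rel r))) ∪ Holds D (violations rs) := rfl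
    rw [h, Set.union_empty_iff, ih, List.forall_mem_cons, Set.eq_empty_iff_forall_notMem]
    simp only [mem_diff, Cond.mem_filter, mem_rel]
    constructor
    · rintro ⟨h1, h2, h3⟩
      exact ⟨h2, fun t ht => by_contra fun hn => h1 t ⟨ht, fun h => hn h.2⟩, h3⟩
    · rintro ⟨h1, h2, h3⟩
      exact ⟨fun t ht => ht.2 ⟨ht.1, h2 t ht.1⟩, h1, h3⟩

/-- The tuples whose first column represents the number `n`. -/
def natExpr : ℕ → Expr
  | 0 => rel .nil
  | n + 1 => join [(2, 0)] (rel .cell) (natExpr n)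

theorem repNat_iff {x n : ℕ} :
    RepNat (fun r => D r.num) x n ↔ ∃ t ∈ Holds D (natExpr n), x = t 0 := by
  induction n generalizing x with
  | zero => rfl
  | succ n ih =>
    simp only [RepNat, IsSucc, ih, natExpr, mem_join, mem_rel, Matches, and_true]
    constructor
    · rintro ⟨_, ⟨s, hs, rfl, rfl⟩, t, ht, h⟩
      exact ⟨s, ⟨hs, t, ht, h⟩, rfl⟩
    · rintro ⟨s, ⟨hs, t, ht, h⟩, rfl⟩
      exact ⟨_, ⟨s, hs, rfl, rfl⟩, t, ht, h⟩

/-- The recorded runs of `c` on the input `[n]`. -/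
def runExpr (c : Code) (n : ℕ) : Expr :=
  join [(0, 0)] (rel (.ev c)) (join [(2, 0)] (join [(1, 0)] (rel .cell) (natExpr n)) (rel .nil))

theorem mem_runExpr {c : Code} {n : ℕ} : t ∈ Holds D (runExpr c n) ↔
    t ∈ D (RelName.ev c).num ∧ RepList (fun r => D r.num) (t 0) [n] := by
  simp only [runExpr, mem_join, mem_rel, Matches, and_true, RepList, repNat_iff, IsNil, IsCell]
  refine and_congr_right fun _ => ?_
  constructor
  · rintro ⟨s, ⟨⟨hs, u, hu, h1⟩, v, hv, h2⟩, h0⟩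
    exact ⟨_, _, ⟨s, hs, h0, rfl, rfl⟩, ⟨u, hu, h1⟩, v, hv, h2⟩
  · rintro ⟨_, _, ⟨s, hs, h0, rfl, rfl⟩, ⟨u, hu, h1⟩, v, hv, h2⟩
    exact ⟨s, ⟨⟨hs, u, hu, h1⟩, v, hv, h2⟩, h0⟩

/-- The recorded runs of `c` on the input `[n]`, provided that nothing is violated. -/
def haltExpr (c : Code) (n : ℕ) : Expr :=
  .diff (runExpr c n) (join [] (runExpr c n) (violations (names c)))

theorem mem_haltExpr {c : Code} {n : ℕ} : t ∈ Holds D (haltExpr c n) ↔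
    t ∈ Holds D (runExpr c n) ∧ Holds D (violations (names c)) = ∅ := by
  simp only [haltExpr, mem_diff, mem_join, Matches, and_true, Set.eq_empty_iff_forall_notMem]
  constructor
  · rintro ⟨h1, h2⟩
    exact ⟨h1, fun s hs => h2 ⟨h1, s, hs⟩⟩
  · rintro ⟨h1, h2⟩
    exact ⟨h1, fun ⟨_, s, hs⟩ => h2 s hs⟩

end Eval

/-- The database over the numerical schema described by a set of facts. -/
def database (F : Set (RelName × Tup)) (R : ℕ) : Set Tup :=
  {t | ∃ r, RelName.num r = R ∧ t ∈ facts F r}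

theorem database_num (F : Set (RelName × Tup)) (r : RelName) :
    database F r.num = facts F r := by
  ext t
  constructor
  · rintro ⟨s, hs, ht⟩
    rwa [← RelName.num_injective hs]
  · exact fun ht => ⟨r, rfl, ht⟩

theorem finite_database {F : Set (RelName × Tup)} (hF : F.Finite) (R : ℕ) :
    (database F R).Finite := by
  refine (hF.image Prod.snd).subset ?_
  rintro t ⟨r, -, ht⟩
  exact ⟨(r, t), ht, rfl⟩

theorem haltExpr_satisfiable_iff {c : Code} {n : ℕ} :
    (∃ D : ℕ → Set Tup, (∀ R, (D R).Finite) ∧ (Holds D (haltExpr c n)).Nonempty) ↔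
      (c.eval [n]).Dom := by
  constructor
  · rintro ⟨D, hfin, t, ht⟩
    obtain ⟨ht, hv⟩ := mem_haltExpr.1 ht
    obtain ⟨ht, hl⟩ := mem_runExpr.1 ht
    obtain ⟨hD, hrule⟩ := violations_eq_empty.1 hv
    obtain ⟨l', hl', -⟩ := hD.sound (fun r => hfin r.num) c hrule _ _ _ ⟨t, ht, rfl, rfl⟩ hl
    exact Part.dom_iff_mem.2 ⟨l', hl'⟩
  · intro h
    obtain ⟨l', hl'⟩ := Part.dom_iff_mem.1 h
    obtain ⟨F, hF, ⟨t, ht, h0, -⟩, hl⟩ := exists_supported_run hl'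
    have hD : (fun r : RelName => database F r.num) = facts F := funext (database_num F)
    refine ⟨database F, finite_database hF.finite, t, ?_⟩
    rw [mem_haltExpr, mem_runExpr, violations_eq_empty, hD, database_num, ← h0]
    exact ⟨⟨ht, hl⟩, coherent_of_trueFact hF.trueFact, fun r _ => database_num F r ▸ hF.rule r⟩

theorem primrec_code_natExpr : Primrec fun n => (natExpr n).code := by
  have h : (fun n => (natExpr n).code) = fun n => Nat.rec (natExpr 0).code
      (fun _ m => Nat.pair 8 (Nat.pair 5 (Nat.pair (EqForm.code (matchForm [(2, 0)]))
        (Nat.pair (rel .cell).code m)))) n := by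
    funext n
    induction n with
    | zero => rfl
    | succ n ih => exact congrArg (fun m => Nat.pair 8 (Nat.pair 5 (Nat.pair
        (EqForm.code (matchForm [(2, 0)])) (Nat.pair (rel .cell).code m)))) ih
  rw [h]
  refine Primrec.nat_rec₁ _ ?_
  exact Primrec₂.natPair.comp (Primrec.const _) <| Primrec₂.natPair.comp (Primrec.const _) <|
    Primrec₂.natPair.comp (Primrec.const _) <|
    Primrec₂.natPair.comp (Primrec.const _) Primrec.snd

theorem primrec_code_join {ps : List (Fin 8 × Fin 8)} {E F : ℕ → Expr}
    (hE : Primrec fun n => (E n).code) (hF : Primrec fun n => (F n).code) :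
    Primrec fun n => (join ps (E n) (F n)).code :=
  Primrec₂.natPair.comp (Primrec.const _) <| Primrec₂.natPair.comp (Primrec.const _) <|
    Primrec₂.natPair.comp (Primrec.const _) <| Primrec₂.natPair.comp hE hF

theorem primrec_code_haltExpr (c : Code) : Primrec fun n => (haltExpr c n).code := by
  have hrun : Primrec fun n => (runExpr c n).code :=
    primrec_code_join (Primrec.const _) <| primrec_code_join
      (primrec_code_join (Primrec.const _) primrec_code_natExpr) (Primrec.const _)
  exact Primrec₂.natPair.comp (Primrec.const _) <| Primrec₂.natPair.comp (Primrec.const _) <|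
    Primrec₂.natPair.comp hrun (primrec_code_join hrun (Primrec.const _))

theorem exists_code_halting : ∃ c : Code, ¬ ComputablePred fun n : ℕ => (c.eval [n]).Dom := by
  have hu : Partrec fun n : ℕ => (Denumerable.ofNat Nat.Partrec.Code n).eval 0 :=
    Nat.Partrec.Code.eval_part.comp (Computable.ofNat _) (Computable.const 0)
  obtain ⟨c, hc⟩ := Code.exists_code (Nat.Partrec'.part_iff₁.2 hu)
  refine ⟨c, fun h => ComputablePred.halting_problem 0 ?_⟩
  obtain ⟨f, hf, hp⟩ := ComputablePred.computable_iff.1 h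
  refine ComputablePred.computable_iff.2 ⟨fun d => f (Encodable.encode d),
    hf.comp Computable.encode, ?_⟩
  funext d
  rw [← congrFun hp (Encodable.encode d)]
  have := hc (Encodable.encode d ::ᵥ List.Vector.nil)
  have h' : c.eval [Encodable.encode d] = pure <$> d.eval 0 := by
    simp only [List.Vector.head_cons, Denumerable.ofNat_encode] at this
    exact this
  rw [h']
  rfl

end SemijoinUndecidable

/-- Finite satisfiability of SA≠ expressions is undecidable: it is
not the case that for every (computable) schema there is a computable function that,
given (the code of) an SA≠ expression `E` over that schema, decides whether there is
a finite database `D`, with values in the countably infinite universe `ℕ`, such that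
`E(D) ≠ ∅`. -/
theorem stmt6 :
    ¬ ∀ ar : ℕ → ℕ, Computable ar →
        ∃ f : ℕ → Bool, Computable f ∧
          ∀ (k : ℕ) (E : SA ℕ ar Empty (fun p => p.elim) k),
            f E.code = true ↔
              ∃ D : ∀ R : ℕ, Set (Fin (ar R) → ℕ),
                (∀ R : ℕ, (D R).Finite) ∧
                  (E.eval (fun p => p.elim) D).Nonempty := by
  intro h
  obtain ⟨f, hf, hspec⟩ := h (fun _ => 8) (Computable.const 8)
  obtain ⟨c, hc⟩ := SemijoinUndecidable.exists_code_halting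
  refine hc (ComputablePred.computable_iff.2 ⟨fun n => f (SemijoinUndecidable.haltExpr c n).code,
    hf.comp (SemijoinUndecidable.primrec_code_haltExpr c).to_comp, funext fun n => propext ?_⟩)
  exact SemijoinUndecidable.haltExpr_satisfiable_iff.symm.trans (hspec 8 _).symm
end

section
/- If the duplicator wins the m-round semijoin game SG_m⟨ā; b̄⟩ on databases A and B, then for every semijoin algebra expression E with at most m nested semijoins and projections, ā ∈ E(A) if and only if b̄ ∈ E(B). -/
/-- Membership in the tuple space of a database: `t` is a projection (onto a strictly
increasing sequence of columns) of some tuple of some relation of `D`. -/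
def inTupleSpace {S : Type} {ar : S → ℕ} {U : Type}
    (D : ∀ R : S, Set (Fin (ar R) → U)) {k : ℕ} (t : Fin k → U) : Prop :=
  ∃ (R : S) (f : Fin k → Fin (ar R)), StrictMono f ∧ ∃ a ∈ D R, t = a ∘ f

/-- Condition (1) of the semijoin game: the tuples `a` and `b` belong to exactly the
same projections `π_X(A(R))` resp. `π_X(B(R))`. -/
def samePos {S : Type} {ar : S → ℕ} {U : Type}
    (A B : ∀ R : S, Set (Fin (ar R) → U)) {k : ℕ} (a b : Fin k → U) : Prop :=
  ∀ (R : S) (f : Fin k → Fin (ar R)), StrictMono f →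
    ((∃ t ∈ A R, a = t ∘ f) ↔ (∃ t ∈ B R, b = t ∘ f))

/-- Condition (2) of the semijoin game: the tuples `a` and `b` satisfy exactly the
same atomic formulas over the vocabulary `Ω` (equality included). -/
def sameAtomic {Ω : Type} {ωar : Ω → ℕ} {U : Type}
    (I : ∀ p : Ω, (Fin (ωar p) → U) → Prop) {k : ℕ} (a b : Fin k → U) : Prop :=
  (∀ i j : Fin k, a i = a j ↔ b i = b j) ∧
  ∀ (p : Ω) (v : Fin (ωar p) → Fin k), (I p (a ∘ v) ↔ I p (b ∘ v))

/-- The duplicator wins the `m`-round semijoin game on the databases `A` and `B`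
starting from the configuration `⟨a; b⟩`: the configuration satisfies the winning
conditions for the 0-round game, and (if `m > 0`) for every spoiler move (a tuple in
the tuple space of `A`, or of `B`) the duplicator has a legal answer in the other
tuple space from which he wins the game with one round less. -/
def DuplicatorWins {S : Type} {ar : S → ℕ} {Ω : Type} {ωar : Ω → ℕ} {U : Type}
    (A B : ∀ R : S, Set (Fin (ar R) → U))
    (I : ∀ p : Ω, (Fin (ωar p) → U) → Prop) :
    ℕ → ∀ {k : ℕ}, (Fin k → U) → (Fin k → U) → Prop
  | 0, _, a, b => samePos A B a b ∧ sameAtomic I a b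
  | m + 1, _, a, b =>
      (samePos A B a b ∧ sameAtomic I a b) ∧
      (∀ (l : ℕ) (c : Fin l → U), inTupleSpace A c →
        ∃ d : Fin l → U, inTupleSpace B d ∧ samePos A B c d ∧
          sameAtomic I (Fin.append a c) (Fin.append b d) ∧
          DuplicatorWins A B I m c d) ∧
      (∀ (l : ℕ) (d : Fin l → U), inTupleSpace B d →
        ∃ c : Fin l → U, inTupleSpace A c ∧ samePos A B c d ∧
          sameAtomic I (Fin.append a c) (Fin.append b d) ∧
          DuplicatorWins A B I m c d)

/-- The number of nested semijoin and projection operators in an SA expression. -/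
def SA.sjpDepth {S : Type} {ar : S → ℕ} {Ω : Type} {ωar : Ω → ℕ} :
    ∀ {n : ℕ}, SA S ar Ω ωar n → ℕ
  | _, .rel _ => 0
  | _, .union E₁ E₂ => max E₁.sjpDepth E₂.sjpDepth
  | _, .diff E₁ E₂ => max E₁.sjpDepth E₂.sjpDepth
  | _, .proj _ _ E => E.sjpDepth + 1
  | _, .sel _ E => E.sjpDepth
  | _, .semijoin _ E₁ E₂ => max E₁.sjpDepth E₂.sjpDepth + 1

/-- Tuples agreeing on all atomic formulas agree on all quantifier-free formulas. -/
theorem sameAtomic.holds_iff {Ω : Type} {ωar : Ω → ℕ} {U : Type}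
    {I : ∀ p : Ω, (Fin (ωar p) → U) → Prop} {n : ℕ} {a b : Fin n → U}
    (h : sameAtomic I a b) (θ : QF Ω ωar n) : QF.holds I θ a ↔ QF.holds I θ b := by
  induction θ with
  | atom p v => simpa only [QF.holds] using h.2 p v
  | eq i j => simpa only [QF.holds] using h.1 i j
  | not φ ih => simp only [QF.holds, ih]
  | and φ ψ ih₁ ih₂ => simp only [QF.holds, ih₁, ih₂]
  | or φ ψ ih₁ ih₂ => simp only [QF.holds, ih₁, ih₂]

/-- If `(a, c)` and `(b, d)` satisfy the same equalities, then `a` is the projection of `c`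
along `f` iff `b` is the projection of `d` along `f`. -/
theorem sameAtomic.eq_comp_iff {Ω : Type} {ωar : Ω → ℕ} {U : Type}
    {I : ∀ p : Ω, (Fin (ωar p) → U) → Prop} {k l : ℕ} {a b : Fin k → U} {c d : Fin l → U}
    (h : sameAtomic I (Fin.append a c) (Fin.append b d)) (f : Fin k → Fin l) :
    a = c ∘ f ↔ b = d ∘ f := by
  simp only [funext_iff, Function.comp_apply]
  refine forall_congr' fun i => ?_
  simpa using h.1 (Fin.castAdd l i) (Fin.natAdd k (f i))

/-- Every tuple in the value of an SA expression belongs to the tuple space. -/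
theorem SA.inTupleSpace_of_mem_eval {S : Type} {ar : S → ℕ} {Ω : Type} {ωar : Ω → ℕ} {U : Type}
    {I : ∀ p : Ω, (Fin (ωar p) → U) → Prop} {D : ∀ R : S, Set (Fin (ar R) → U)}
    {n : ℕ} (E : SA S ar Ω ωar n) {a : Fin n → U} (ha : a ∈ E.eval I D) :
    inTupleSpace D a := by
  induction E with
  | rel R => exact ⟨R, id, strictMono_id, a, ha, rfl⟩
  | union E₁ E₂ ih₁ ih₂ => exact ha.elim ih₁ ih₂
  | diff E₁ E₂ ih₁ ih₂ => exact ih₁ ha.1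
  | proj f hf E ih =>
    obtain ⟨c, hc, rfl⟩ := ha
    obtain ⟨R, g, hg, t, ht, rfl⟩ := ih hc
    exact ⟨R, g ∘ f, hg.comp hf, t, ht, rfl⟩
  | sel θ E ih => exact ih ha.1
  | semijoin θ E₁ E₂ ih₁ ih₂ => exact ih₁ ha.1

theorem DuplicatorWins.initial {S : Type} {ar : S → ℕ} {Ω : Type} {ωar : Ω → ℕ} {U : Type}
    {A B : ∀ R : S, Set (Fin (ar R) → U)} {I : ∀ p : Ω, (Fin (ωar p) → U) → Prop}
    {m k : ℕ} {a b : Fin k → U} (h : DuplicatorWins A B I m a b) :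
    samePos A B a b ∧ sameAtomic I a b := by
  cases m with
  | zero => exact h
  | succ m => exact h.1

/-- An SA expression of depth at most `m` does not distinguish configurations from which the
duplicator wins the `m`-round game. -/
theorem DuplicatorWins.mem_eval_iff {S : Type} {ar : S → ℕ} {Ω : Type} {ωar : Ω → ℕ} {U : Type}
    {A B : ∀ R : S, Set (Fin (ar R) → U)} {I : ∀ p : Ω, (Fin (ωar p) → U) → Prop}
    {m k : ℕ} {a b : Fin k → U} (h : DuplicatorWins A B I m a b)
    (E : SA S ar Ω ωar k) (hE : E.sjpDepth ≤ m) : a ∈ E.eval I A ↔ b ∈ E.eval I B := by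
  induction E generalizing m with
  | rel R => simpa [SA.eval] using h.initial.1 R id strictMono_id
  | union E₁ E₂ ih₁ ih₂ =>
    obtain ⟨h₁, h₂⟩ := max_le_iff.1 hE
    exact or_congr (ih₁ h h₁) (ih₂ h h₂)
  | diff E₁ E₂ ih₁ ih₂ =>
    obtain ⟨h₁, h₂⟩ := max_le_iff.1 hE
    exact and_congr (ih₁ h h₁) (not_congr (ih₂ h h₂))
  | proj f hf E ih =>
    obtain _ | m := m
    · exact absurd hE (Nat.not_succ_le_zero _)
    have hE' : E.sjpDepth ≤ m := Nat.le_of_succ_le_succ hE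
    constructor
    · rintro ⟨c, hc, hac⟩
      obtain ⟨d, -, -, hat, hw⟩ := h.2.1 _ c (E.inTupleSpace_of_mem_eval hc)
      exact ⟨d, (ih hw hE').1 hc, (hat.eq_comp_iff f).1 hac⟩
    · rintro ⟨d, hd, hbd⟩
      obtain ⟨c, -, -, hat, hw⟩ := h.2.2 _ d (E.inTupleSpace_of_mem_eval hd)
      exact ⟨c, (ih hw hE').2 hd, (hat.eq_comp_iff f).2 hbd⟩
  | sel θ E ih => exact and_congr (ih h hE) (h.initial.2.holds_iff θ)
  | semijoin θ E₁ E₂ ih₁ ih₂ =>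
    obtain _ | m := m
    · exact absurd hE (Nat.not_succ_le_zero _)
    obtain ⟨h₁, h₂⟩ := max_le_iff.1 (Nat.le_of_succ_le_succ hE)
    refine and_congr (ih₁ h (Nat.le_succ_of_le h₁)) ⟨?_, ?_⟩
    · rintro ⟨c, hc, hθ⟩
      obtain ⟨d, -, -, hat, hw⟩ := h.2.1 _ c (E₂.inTupleSpace_of_mem_eval hc)
      exact ⟨d, (ih₂ hw h₂).1 hc, (hat.holds_iff θ).1 hθ⟩
    · rintro ⟨d, hd, hθ⟩
      obtain ⟨c, -, -, hat, hw⟩ := h.2.2 _ d (E₂.inTupleSpace_of_mem_eval hd)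
      exact ⟨c, (ih₂ hw h₂).2 hd, (hat.holds_iff θ).2 hθ⟩

/-- If the duplicator wins the `m`-round semijoin game `SG_m⟨a; b⟩`
on the databases `A` and `B`, then for every semijoin algebra expression `E` with at
most `m` nested semijoins and projections, `a ∈ E(A)` iff `b ∈ E(B)`. -/
theorem stmt8 {U : Type} {S : Type} {Ω : Type} (ar : S → ℕ) (ωar : Ω → ℕ)
    (I : ∀ p : Ω, (Fin (ωar p) → U) → Prop)
    (A B : ∀ R : S, Set (Fin (ar R) → U))
    (hA : ∀ R : S, (A R).Finite) (hB : ∀ R : S, (B R).Finite)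
    {k : ℕ} (a b : Fin k → U)
    (ha : inTupleSpace A a) (hb : inTupleSpace B b)
    (m : ℕ) (hwin : DuplicatorWins A B I m a b) :
    ∀ E : SA S ar Ω ωar k, E.sjpDepth ≤ m →
      (a ∈ E.eval I A ↔ b ∈ E.eval I B) :=
  hwin.mem_eval_iff
end

section
/- Transitivity is inexpressible in the semijoin algebra: over the schema with a single binary relation R and vocabulary Ω = {=}, there is no 0-ary SA expression E such that for every database D, E(D) ≠ ∅ if and only if D(R) is a transitive relation. -/
/-- Two tuples have the same equality type. -/
def SameEqType {U V : Type} {n : ℕ} (s : Fin n → U) (t : Fin n → V) : Prop :=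
  ∀ i j, s i = s j ↔ t i = t j

theorem SameEqType.symm {U V : Type} {n : ℕ} {s : Fin n → U} {t : Fin n → V}
    (h : SameEqType s t) : SameEqType t s :=
  fun i j => (h i j).symm

theorem SameEqType.comp {U V : Type} {n k : ℕ} {s : Fin n → U} {t : Fin n → V}
    (h : SameEqType s t) (f : Fin k → Fin n) : SameEqType (s ∘ f) (t ∘ f) :=
  fun i j => h (f i) (f j)

theorem SameEqType.holds_iff {U V : Type} {n : ℕ} (θ : EqForm n) {s : Fin n → U}
    {t : Fin n → V} (h : SameEqType s t) : θ.holds s ↔ θ.holds t := by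
  unfold EqForm.holds
  induction θ with
  | atom p v => exact p.elim
  | eq i j => simpa only [QF.holds] using h i j
  | not φ ih => simpa only [QF.holds] using not_congr ih
  | and φ ψ ih₁ ih₂ => simpa only [QF.holds] using and_congr ih₁ ih₂
  | or φ ψ ih₁ ih₂ => simpa only [QF.holds] using or_congr ih₁ ih₂

/-- The concatenation of `a ∘ f` and `c ∘ g` is a rearrangement of that of `a` and `c`. -/
theorem append_comp_eq {U : Type} {n m k l : ℕ} (a : Fin n → U) (c : Fin m → U)
    (f : Fin k → Fin n) (g : Fin l → Fin m) :
    Fin.append (a ∘ f) (c ∘ g) =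
      Fin.append a c ∘ Fin.append (Fin.castAdd m ∘ f) (Fin.natAdd n ∘ g) := by
  funext i
  refine Fin.addCases (fun i => ?_) (fun i => ?_) i <;> simp

theorem SameEqType.right {U V : Type} {n m : ℕ} {a : Fin n → U} {c : Fin m → U}
    {b : Fin n → V} {d : Fin m → V}
    (h : SameEqType (Fin.append a c) (Fin.append b d)) : SameEqType c d :=
  fun i j => by simpa using h (Fin.natAdd n i) (Fin.natAdd n j)

theorem SameEqType.append_comp {U V : Type} {n m k l : ℕ} {a : Fin n → U} {c : Fin m → U}
    {b : Fin n → V} {d : Fin m → V}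
    (h : SameEqType (Fin.append a c) (Fin.append b d)) (f : Fin k → Fin n)
    (g : Fin l → Fin m) :
    SameEqType (Fin.append (a ∘ f) (c ∘ g)) (Fin.append (b ∘ f) (d ∘ g)) := by
  rw [append_comp_eq a c f g, append_comp_eq b d f g]
  exact h.comp _

theorem SameEqType.comp_eq_comp {U V : Type} {n m k : ℕ} {a : Fin n → U} {c : Fin m → U}
    {b : Fin n → V} {d : Fin m → V}
    (h : SameEqType (Fin.append a c) (Fin.append b d)) {f : Fin k → Fin n}
    {g : Fin k → Fin m} (hac : a ∘ f = c ∘ g) : b ∘ f = d ∘ g := by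
  funext i
  simpa using (h (Fin.castAdd m (f i)) (Fin.natAdd n (g i))).1 (by simpa using congrFun hac i)

/-- Given tuples of `A` and `B` with the same equality type, every further tuple of
`A` is answered by a tuple of `B` in the same position relative to the current pair of tuples. -/
def Forth {U : Type} (A B : Set (Fin 2 → U)) : Prop :=
  ∀ a ∈ A, ∀ b ∈ B, SameEqType a b →
    ∀ c ∈ A, ∃ d ∈ B, SameEqType (Fin.append a c) (Fin.append b d)

/-- Membership in a relation is preserved by rearranging and repeating columns, i.e. the
relation is reflexive on its field and symmetric. -/
def ColumnClosed {U : Type} (A : Set (Fin 2 → U)) : Prop :=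
  ∀ a ∈ A, ∀ f : Fin 2 → Fin 2, a ∘ f ∈ A

/-- Semijoin expressions over a binary relation. -/
abbrev BinSA (n : ℕ) : Type := SA Unit (fun _ => 2) Empty (fun p => p.elim) n

/-- The value of a semijoin expression on a binary relation. -/
abbrev BinSA.val {U : Type} (D : Set (Fin 2 → U)) {n : ℕ} (E : BinSA n) : Set (Fin n → U) :=
  E.eval (fun p => p.elim) (fun _ : Unit => D)

theorem BinSA.exists_eq_comp {U : Type} (D : Set (Fin 2 → U)) {n : ℕ} (E : BinSA n)
    {t : Fin n → U} (ht : t ∈ E.val D) : ∃ a ∈ D, ∃ f : Fin n → Fin 2, t = a ∘ f := by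
  induction E with
  | rel R => exact ⟨t, ht, id, rfl⟩
  | union E₁ E₂ ih₁ ih₂ => exact ht.elim ih₁ ih₂
  | diff E₁ E₂ ih₁ _ => exact ih₁ ht.1
  | proj g _ E ih =>
    obtain ⟨s, hs, rfl⟩ := ht
    obtain ⟨a, ha, f, rfl⟩ := ih hs
    exact ⟨a, ha, f ∘ g, rfl⟩
  | sel θ E ih => exact ih ht.1
  | semijoin θ E₁ E₂ ih₁ _ => exact ih₁ ht.1

theorem BinSA.mem_val_of_sameEqType {U : Type} {A B : Set (Fin 2 → U)} (hA : ColumnClosed A)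
    (hB : ColumnClosed B) (hAB : Forth A B) (hBA : Forth B A) {n : ℕ} (E : BinSA n)
    {a b : Fin 2 → U} (ha : a ∈ A) (hb : b ∈ B) (h : SameEqType a b) (f : Fin n → Fin 2)
    (hf : a ∘ f ∈ E.val A) : b ∘ f ∈ E.val B := by
  induction E generalizing A B a b with
  | rel R => exact hB b hb f
  | union E₁ E₂ ih₁ ih₂ =>
    exact hf.imp (ih₁ hA hB hAB hBA ha hb h f) (ih₂ hA hB hAB hBA ha hb h f)
  | diff E₁ E₂ ih₁ ih₂ =>
    exact ⟨ih₁ hA hB hAB hBA ha hb h f hf.1,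
      fun hn => hf.2 (ih₂ hB hA hBA hAB hb ha h.symm f hn)⟩
  | proj g _ E ih =>
    obtain ⟨s, hs, has⟩ := hf
    obtain ⟨c, hc, k, rfl⟩ := BinSA.exists_eq_comp A E hs
    obtain ⟨d, hd, hcd⟩ := hAB a ha b hb h c hc
    exact ⟨d ∘ k, ih hA hB hAB hBA hc hd hcd.right k hs, hcd.comp_eq_comp (g := k ∘ g) has⟩
  | sel θ E ih =>
    exact ⟨ih hA hB hAB hBA ha hb h f hf.1, ((h.comp f).holds_iff θ).1 hf.2⟩
  | semijoin θ E₁ E₂ ih₁ ih₂ =>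
    obtain ⟨hf₁, s, hs, hθ⟩ := hf
    obtain ⟨c, hc, k, rfl⟩ := BinSA.exists_eq_comp A E₂ hs
    obtain ⟨d, hd, hcd⟩ := hAB a ha b hb h c hc
    exact ⟨ih₁ hA hB hAB hBA ha hb h f hf₁, d ∘ k,
      ih₂ hA hB hAB hBA hc hd hcd.right k hs, ((hcd.append_comp f k).holds_iff θ).1 hθ⟩

/-- The binary relation over `U` given by a relation `G` on a set `V` of labels. -/
def labelled {U V : Type} (e : V → U) (G : V → V → Prop) : Set (Fin 2 → U) :=
  {t | ∃ i j, G i j ∧ t = ![e i, e j]}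

theorem labelled_finite {U V : Type} [Finite V] (e : V → U) (G : V → V → Prop) :
    (labelled e G).Finite := by
  refine (Set.finite_range fun p : V × V => ![e p.1, e p.2]).subset ?_
  rintro _ ⟨i, j, -, rfl⟩
  exact ⟨(i, j), rfl⟩

theorem labelled_columnClosed {U V : Type} (e : V → U) {G : V → V → Prop}
    (hr : ∀ i, G i i) (hs : ∀ i j, G i j → G j i) : ColumnClosed (labelled e G) := by
  rintro _ ⟨i, j, hij, rfl⟩ f
  refine ⟨![i, j] (f 0), ![i, j] (f 1), ?_, ?_⟩
  · generalize f 0 = x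
    generalize f 1 = y
    fin_cases x <;> fin_cases y
    exacts [hr i, hij, hs i j hij, hr j]
  · funext x
    fin_cases x
    · change ![e i, e j] (f 0) = e (![i, j] (f 0))
      generalize f 0 = y
      fin_cases y <;> rfl
    · change ![e i, e j] (f 1) = e (![i, j] (f 1))
      generalize f 1 = y
      fin_cases y <;> rfl

theorem labelled_forth {U V : Type} {e : V → U} (he : e.Injective) {G H : V → V → Prop}
    (hGH : ∀ a₀ a₁, G a₀ a₁ → ∀ b₀ b₁, H b₀ b₁ → (a₀ = a₁ ↔ b₀ = b₁) → ∀ c₀ c₁, G c₀ c₁ →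
      ∃ d₀ d₁, H d₀ d₁ ∧ (c₀ = c₁ ↔ d₀ = d₁) ∧ (a₀ = c₀ ↔ b₀ = d₀) ∧ (a₀ = c₁ ↔ b₀ = d₁) ∧
        (a₁ = c₀ ↔ b₁ = d₀) ∧ (a₁ = c₁ ↔ b₁ = d₁)) :
    Forth (labelled e G) (labelled e H) := by
  rintro _ ⟨a₀, a₁, ha, rfl⟩ _ ⟨b₀, b₁, hb, rfl⟩ hab _ ⟨c₀, c₁, hc, rfl⟩
  have hab' : a₀ = a₁ ↔ b₀ = b₁ := by simpa [he.eq_iff] using hab 0 1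
  obtain ⟨d₀, d₁, hd, h₁, h₂, h₃, h₄, h₅⟩ := hGH a₀ a₁ ha b₀ b₁ hb hab' c₀ c₁ hc
  refine ⟨_, ⟨d₀, d₁, hd, rfl⟩, fun i j => ?_⟩
  refine Fin.addCases (fun i => ?_) (fun i => ?_) i <;>
    refine Fin.addCases (fun j => ?_) (fun j => ?_) j <;>
    simp only [Fin.append_left, Fin.append_right] <;>
    fin_cases i <;> fin_cases j <;>
    simp [he.eq_iff] <;> grind

/-- The complete relation and the reflexive four-cycle have the same one-step extensions. -/
theorem labelled_forth_fourCycle {U : Type} {e : Fin 4 → U} (he : e.Injective) :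
    Forth (labelled e fun _ _ => True) (labelled e fun i j => j ≠ i + 2) :=
  labelled_forth he (by decide +kernel)

theorem labelled_fourCycle_forth {U : Type} {e : Fin 4 → U} (he : e.Injective) :
    Forth (labelled e fun i j => j ≠ i + 2) (labelled e fun _ _ => True) :=
  labelled_forth he (by decide +kernel)

/-- Transitivity is inexpressible in the semijoin algebra: over the
schema with a single binary relation name `R` and vocabulary `Ω = {=}` (encoded as
`Ω = Empty`, since equality is built in), there is no 0-ary SA expression `E` such
that for every database `D`, `E(D) ≠ ∅` iff `D(R)` is transitive. -/
theorem stmt10 {U : Type} [Infinite U] :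
    ¬ ∃ E : SA Unit (fun _ => 2) Empty (fun p => p.elim) 0,
        ∀ D : Set (Fin 2 → U), D.Finite →
          (((E.eval (fun p => p.elim) (fun _ : Unit => D)).Nonempty) ↔
            ∀ s ∈ D, ∀ t ∈ D, s 1 = t 0 → ![s 0, t 1] ∈ D) := by
  rintro ⟨E, hE⟩
  let e : Fin 4 → U := fun i => Infinite.natEmbedding U i
  have he : e.Injective := (Infinite.natEmbedding U).injective.comp Fin.val_injective
  have hA : (BinSA.val (labelled e fun _ _ => True) E).Nonempty := by
    rw [hE _ (labelled_finite _ _)]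
    rintro _ ⟨i, j, -, rfl⟩ _ ⟨k, l, -, rfl⟩ -
    exact ⟨i, l, trivial, rfl⟩
  have hB : (BinSA.val (labelled e fun i j => j ≠ i + 2) E).Nonempty := by
    obtain ⟨t, ht⟩ := hA
    refine ⟨_, BinSA.mem_val_of_sameEqType (a := ![e 0, e 0]) (b := ![e 0, e 0])
      (labelled_columnClosed e (by decide) (by decide))
      (labelled_columnClosed e (by decide) (by decide))
      (labelled_forth_fourCycle he) (labelled_fourCycle_forth he) E
      ⟨0, 0, trivial, rfl⟩ ⟨0, 0, by decide, rfl⟩ (fun _ _ => Iff.rfl) Fin.elim0 ?_⟩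
    rwa [Subsingleton.elim (_ ∘ _) t]
  rw [hE _ (labelled_finite _ _)] at hB
  obtain ⟨i, j, hij, h⟩ := hB _ ⟨0, 1, by decide, rfl⟩ _ ⟨1, 2, by decide, rfl⟩ rfl
  have hi : 0 = i := he (congrFun h 0)
  have hj : 2 = j := he (congrFun h 1)
  subst hi hj
  exact hij rfl
end

section
/- On ordered databases, the SA expressions defined inductively by at_least(1) := S and at_least(k) := S ⋉_{x_1 < y_1} at_least(k−1) satisfy: for every database D over the schema {S} with S unary and every k ≥ 1, at_least(k)(D) ≠ ∅ if and only if D(S) contains at least k elements. In particular, this query is order-invariant but expressible in the semijoin algebra with order. -/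
/-- The SA expressions `at_least(k)` over the schema with one unary relation name `S`
and the ordered vocabulary `Ω = {=, <}` (encoded with `Ω = Unit` carrying the single
binary predicate `<`, equality being built in), defined inductively by
`at_least(1) := S` and `at_least(k) := S ⋉_(x₁ < y₁) at_least(k-1)`. -/
def atLeast : ℕ → SA Unit (fun _ => 1) Unit (fun _ => 2) 1
  | 0 => SA.rel ()
  | 1 => SA.rel ()
  | k + 2 =>
      SA.semijoin (QF.atom () (fun i : Fin 2 => (i : Fin (1 + 1))))
        (SA.rel ()) (atLeast (k + 1))

/-- A finite set has at least `k + 1` elements iff one of them has at least `k` elements of the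
set above it. -/
theorem succ_le_ncard_iff_exists_le_ncard_above {α : Type*} (r : α → α → Prop)
    [IsStrictTotalOrder α r] {A : Set α} (hA : A.Finite) (k : ℕ) :
    k + 1 ≤ A.ncard ↔ ∃ b ∈ A, k ≤ {c ∈ A | r b c}.ncard := by
  have card_insert (b : α) :
      (insert b {c ∈ A | r b c}).ncard = {c ∈ A | r b c}.ncard + 1 :=
    Set.ncard_insert_of_notMem (fun h => irrefl_of r b h.2) (hA.subset (Set.sep_subset _ _))
  constructor
  · intro h
    have hne : A.Nonempty := by
      rw [← Set.ncard_pos hA]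
      omega
    obtain ⟨b, -, hmin⟩ := (hA.wellFoundedOn (r := r)).has_min
      (Set.univ : Set A) ⟨⟨_, hne.some_mem⟩, trivial⟩
    refine ⟨b, b.2, ?_⟩
    have hsub : A ⊆ insert b.1 {c ∈ A | r b c} := by
      intro c hc
      rcases trichotomous_of r b.1 c with hbc | hbc | hbc
      · exact Or.inr ⟨hc, hbc⟩
      · exact Or.inl hbc.symm
      · exact absurd hbc (hmin ⟨c, hc⟩ trivial)
    have := Set.ncard_le_ncard hsub ((hA.subset (Set.sep_subset _ _)).insert _)
    rw [card_insert] at this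
    omega
  · rintro ⟨b, hb, h⟩
    have hsub : insert b {c ∈ A | r b c} ⊆ A := Set.insert_subset hb (Set.sep_subset _ _)
    have := Set.ncard_le_ncard hsub hA
    rw [card_insert] at this
    omega

/-- The strict total order on one-column tuples induced by the order of the universe. -/
theorem isStrictTotalOrder_apply_zero {U : Type} (lt : U → U → Prop) [IsStrictTotalOrder U lt] :
    IsStrictTotalOrder (Fin 1 → U) (fun a b => lt (a 0) (b 0)) where
  trichotomous a b hab hba := by
    ext i
    rw [Subsingleton.elim i 0]
    rcases trichotomous_of lt (a 0) (b 0) with h | h | h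
    · exact absurd h hab
    · exact h
    · exact absurd h hba
  irrefl a := irrefl_of lt (a 0)
  trans _ _ _ := trans_of lt

/-- `atLeast (k + 1)` selects the tuples with at least `k` tuples above them. -/
theorem mem_eval_atLeast_succ {U : Type} (lt : U → U → Prop) [IsStrictTotalOrder U lt]
    (D : Set (Fin 1 → U)) (hD : D.Finite) (k : ℕ) (a : Fin 1 → U) :
    a ∈ (atLeast (k + 1)).eval (fun _ t => lt (t 0) (t 1)) (fun _ : Unit => D) ↔
      a ∈ D ∧ k ≤ {b ∈ D | lt (a 0) (b 0)}.ncard := by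
  induction k generalizing a with
  | zero => simp [atLeast, SA.eval]
  | succ k ih =>
    have := isStrictTotalOrder_apply_zero lt
    rw [succ_le_ncard_iff_exists_le_ncard_above (fun a b : Fin 1 → U => lt (a 0) (b 0))
      (hD.subset (Set.sep_subset _ _))]
    simp only [atLeast, SA.eval, QF.holds, Set.mem_ofPred_eq]
    change (a ∈ D ∧ ∃ b ∈ (atLeast (k + 1)).eval (fun _ t => lt (t 0) (t 1)) (fun _ : Unit => D),
      lt (a 0) (b 0)) ↔ _
    refine and_congr_right fun _ => exists_congr fun b => ?_
    rw [ih]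
    have habove (hab : lt (a 0) (b 0)) :
        {c ∈ {c ∈ D | lt (a 0) (c 0)} | lt (b 0) (c 0)} = {c ∈ D | lt (b 0) (c 0)} := by
      ext c
      exact ⟨fun h => ⟨h.1.1, h.2⟩, fun h => ⟨⟨h.1, trans_of lt hab h.2⟩, h.2⟩⟩
    constructor
    · rintro ⟨⟨hb, hk⟩, hab⟩
      exact ⟨⟨hb, hab⟩, (habove hab).symm ▸ hk⟩
    · rintro ⟨⟨hb, hab⟩, hk⟩
      exact ⟨⟨hb, habove hab ▸ hk⟩, hab⟩

/-- On ordered databases, for every strict total order `lt` on the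
universe `U` interpreting the predicate `<`, every database `D` over the schema `{S}`
(`S` unary) and every `k ≥ 1`: `at_least(k)(D) ≠ ∅` iff `D(S)` contains at least `k`
elements. (Since this holds for every strict total order `lt` on `U`, the query is
order-invariant, yet it is expressed in the semijoin algebra with order by the
expressions `at_least(k)`.) -/
theorem stmt12 {U : Type} (lt : U → U → Prop) [IsStrictTotalOrder U lt]
    (D : Set (Fin 1 → U)) (hD : D.Finite) (k : ℕ) (hk : 1 ≤ k) :
    ((atLeast k).eval (fun _ t => lt (t 0) (t 1)) (fun _ : Unit => D)).Nonempty ↔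
      k ≤ D.ncard := by
  obtain ⟨k, rfl⟩ := Nat.exists_eq_add_of_le' hk
  have := isStrictTotalOrder_apply_zero lt
  rw [succ_le_ncard_iff_exists_le_ncard_above (fun a b : Fin 1 → U => lt (a 0) (b 0)) hD]
  exact exists_congr fun a => mem_eval_atLeast_succ lt D hD k a
end
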